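/- arXiv:0909.3333 — 2 statements merged into one kernel-verified Lean document; each statement's English description precedes it below -/
import Mathlib

section
/- Consider the dynamic mixture algorithm with mixing probabilities p_i ∈ (0,1) for 1 ≤ i ≤ n−1. Suppose there exists a ∈ (0,1) such that: (3.1) for each 1 ≤ i ≤ n, liminf_{b→∞} inf { (g_i^b(by | bs)/f(by))·F̄(b) : s ≤ 1−(1−a)^{i−1}, y > a(1−s) } > 0, and (3.2) limsup_{b→∞} sup { f(by)/g_n^b(by | bs) : s ≤ 1, y > 1−s } < ∞. Then the normalized Radon–Nikodym derivative R_b is bounded on the set {y ∈ ℝ^n : y_1+⋯+y_n > 1}, uniformly in b: there exist a constant C < ∞ and b_0 > 0 such that R_b(y) ≤ C for all b ≥ b_0 and all y ∈ ℝ^n with y_1+⋯+y_n > 1. -/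
open MeasureTheory Filter Set Real

/-- A mixture sampling density `p f + (1 - p) h` keeps the likelihood ratio below `1 / p`. -/
theorem div_mixture_le_inv {p u v : ℝ} (hp : p ∈ Ioo (0 : ℝ) 1) (hu : 0 ≤ u) (hv : 0 ≤ v) :
    u / (p * u + (1 - p) * v) ≤ p⁻¹ := by
  have hq : 0 ≤ 1 - p := sub_nonneg.2 hp.2.le
  have hp0 := hp.1
  rcases hu.eq_or_lt with rfl | hu
  · simpa using hp0.le
  · rw [div_le_iff₀ (by positivity), mul_add, inv_mul_cancel_left₀ hp0.ne']
    exact le_add_of_nonneg_right (by positivity)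

/-- A lower bound on `v / u * c` turns into an upper bound on `u / v`, and forces `0 < u`, `0 < v`. -/
theorem pos_and_le_of_le_div_mul {ε c u v : ℝ} (hε : 0 < ε) (hc : 0 < c) (hu : 0 ≤ u)
    (h : ε ≤ v / u * c) : 0 < u ∧ 0 < v ∧ u ≤ ε⁻¹ * c * v := by
  have hvu : 0 < v / u := pos_of_mul_pos_left (hε.trans_le h) hc.le
  have hu' : 0 < u := hu.lt_of_ne' fun h0 => by simp [h0] at hvu
  have hv : 0 < v := (div_pos_iff_of_pos_right hu').1 hvu
  refine ⟨hu', hv, ?_⟩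
  rw [div_mul_eq_mul_div, le_div_iff₀ hu'] at h
  rw [mul_assoc, inv_mul_eq_div, le_div_iff₀ hε]
  linarith

/-- The first step at which `s` exceeds the level `1 - (1 - a) ^ k` makes a jump larger than the
fraction `a` of the remaining distance to `1`. -/
theorem exists_large_jump {n : ℕ} {a : ℝ} (ha : a ∈ Ioo (0 : ℝ) 1) {s : ℕ → ℝ} (h0 : s 0 = 0)
    (hn : 1 < s n) :
    ∃ k < n, s k ≤ 1 - (1 - a) ^ k ∧ a * (1 - s k) < s (k + 1) - s k := by
  have hpos : ∀ k, 0 < (1 - a) ^ k := fun k => pow_pos (sub_pos.2 ha.2) k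
  obtain ⟨k, hk, hle, hlt⟩ : ∃ k < n, s k ≤ 1 - (1 - a) ^ k ∧ 1 - (1 - a) ^ (k + 1) < s (k + 1) := by
    by_contra! H
    have key : ∀ k ≤ n, s k ≤ 1 - (1 - a) ^ k := by
      intro k
      induction k with
      | zero => simp [h0]
      | succ k ih => exact fun hk => H k hk (ih (by omega))
    linarith [key n le_rfl, hpos n]
  refine ⟨k, hk, hle, ?_⟩
  rw [pow_succ] at hlt
  nlinarith [ha.2]

/-- Boundedness of the normalized Radon–Nikodym derivative for the dynamic
mixture algorithm under conditions (3.1) and (3.2). -/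
theorem stmt_0
    (n : ℕ) (hn : 1 ≤ n) (α : ℝ) (hα : 0 < α)
    (f : ℝ → ℝ) (hf_nonneg : ∀ x, 0 ≤ f x)
    (hf_int : ∫ x, f x = 1)
    (hf_rv : ∀ x : ℝ, 0 < x →
      Tendsto (fun u => f (u * x) / f u) atTop (nhds (x ^ (-α - 1))))
    (Fbar : ℝ → ℝ) (hFbar : ∀ b, Fbar b = ∫ t in Ioi b, f t)
    (hFbar_pos : ∀ b, 0 < Fbar b)
    (p : ℕ → ℝ) (hp : ∀ i, 1 ≤ i → i < n → p i ∈ Ioo (0 : ℝ) 1)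
    (g : ℕ → ℝ → ℝ → ℝ → ℝ)
    (hg_nonneg : ∀ i b s x, 0 ≤ g i b s x)
    (hg_dens : ∀ i b s, 1 ≤ i → i ≤ n → ∫ x, g i b s x = 1)
    (ψ : ℕ → ℝ → ℝ → ℝ → ℝ)
    (hψ : ∀ i b s x, ψ i b s x =
      if b < s then f x
      else if i < n then p i * f x + (1 - p i) * g i b s x
      else g i b s x)
    (S : (Fin n → ℝ) → ℕ → ℝ)
    (hS : ∀ y k, S y k = ∑ j ∈ Finset.univ.filter (fun j : Fin n => (j : ℕ) < k), y j)
    (R : ℝ → (Fin n → ℝ) → ℝ)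
    (hR : ∀ b y, R b y =
      (Fbar b)⁻¹ * ∏ i : Fin n, f (b * y i) / ψ ((i : ℕ) + 1) b (b * S y (i : ℕ)) (b * y i))
    (a : ℝ) (ha : a ∈ Ioo (0 : ℝ) 1)
    -- condition (3.1)
    (h31 : ∀ i, 1 ≤ i → i ≤ n → ∃ ε > (0 : ℝ), ∃ b0 : ℝ, ∀ b ≥ b0, ∀ s y : ℝ,
      s ≤ 1 - (1 - a) ^ (i - 1) → a * (1 - s) < y →
      ε ≤ g i b (b * s) (b * y) / f (b * y) * Fbar b)
    -- condition (3.2)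
    (h32 : ∃ M : ℝ, ∃ b0 : ℝ, ∀ b ≥ b0, ∀ s y : ℝ,
      s ≤ 1 → 1 - s < y → f (b * y) / g n b (b * s) (b * y) ≤ M) :
    ∃ C : ℝ, ∃ b0 : ℝ, ∀ b ≥ b0, ∀ y : Fin n → ℝ, 1 < S y n → R b y ≤ C := by
  have hS0 : ∀ y, S y 0 = 0 := fun y => by simp [hS]
  have hSsucc : ∀ y (i : Fin n), S y ((i : ℕ) + 1) = S y i + y i := by
    intro y i
    have : Finset.univ.filter (fun j : Fin n => (j : ℕ) < (i : ℕ) + 1) =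
        insert i (Finset.univ.filter (fun j : Fin n => (j : ℕ) < (i : ℕ))) := by
      ext j
      simp only [Finset.mem_filter, Finset.mem_univ, true_and, Finset.mem_insert, Fin.ext_iff]
      omega
    rw [hS, hS, this, Finset.sum_insert (by simp), add_comm]
  have hψ_nonneg : ∀ i b s x, 1 ≤ i → 0 ≤ ψ i b s x := by
    intro i b s x hi
    rw [hψ]
    split_ifs with h1 h2
    · exact hf_nonneg x
    · have hpi := hp i hi h2
      exact add_nonneg (mul_nonneg hpi.1.le (hf_nonneg x))
        (mul_nonneg (sub_nonneg.2 hpi.2.le) (hg_nonneg i b s x))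
    · exact hg_nonneg i b s x
  have hfactor : ∀ i : Fin n, ∃ K : ℝ, ∀ᶠ b in atTop, ∀ s y : ℝ,
      (((i : ℕ) + 1 = n → 1 < s + y) →
        f (b * y) / ψ ((i : ℕ) + 1) b (b * s) (b * y) ≤ K) ∧
      (s ≤ 1 - (1 - a) ^ (i : ℕ) → a * (1 - s) < y →
        f (b * y) / ψ ((i : ℕ) + 1) b (b * s) (b * y) ≤ K * Fbar b) := by
    intro i
    obtain ⟨ε, hε, b₁, h1⟩ := h31 (i + 1) (by omega) (by omega)
    obtain ⟨M, b₂, h2⟩ := h32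
    have hpow : 0 < (1 - a) ^ (i : ℕ) := pow_pos (sub_pos.2 ha.2) _
    by_cases hi : (i : ℕ) + 1 < n
    · have hpi := hp _ (by omega) hi
      have hq : 0 < 1 - p (i + 1) := sub_pos.2 hpi.2
      refine ⟨max 1 (max (p (i + 1))⁻¹ ((1 - p (i + 1))⁻¹ * ε⁻¹)), ?_⟩
      filter_upwards [eventually_gt_atTop 0, eventually_ge_atTop b₁] with b hb hb₁ s y
      refine ⟨fun _ => ?_, fun hs hy => ?_⟩
      · rw [hψ, if_pos hi]
        split_ifs
        · exact (div_self_le_one _).trans (le_max_left _ _)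
        · exact (div_mixture_le_inv hpi (hf_nonneg _) (hg_nonneg _ _ _ _)).trans
            ((le_max_left _ _).trans (le_max_right _ _))
      · have hbs : ¬ b < b * s := by nlinarith
        rw [hψ, if_neg hbs, if_pos hi]
        obtain ⟨hu, hv, huv⟩ := pos_and_le_of_le_div_mul hε (hFbar_pos b) (hf_nonneg _)
          (h1 b hb₁ s y (by simpa using hs) hy)
        refine le_trans ?_ (mul_le_mul_of_nonneg_right
          ((le_max_right _ _).trans (le_max_right _ _)) (hFbar_pos b).le)
        have hF := hFbar_pos b
        have hp0 := hpi.1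
        rw [div_le_iff₀ (by positivity)]
        calc f (b * y) ≤ ε⁻¹ * Fbar b * g (i + 1) b (b * s) (b * y) := huv
          _ = (1 - p (i + 1))⁻¹ * ε⁻¹ * Fbar b *
                ((1 - p (i + 1)) * g (i + 1) b (b * s) (b * y)) := by
              field_simp
          _ ≤ _ := by
              gcongr
              exact le_add_of_nonneg_left (by positivity)
    · have hin : (i : ℕ) + 1 = n := by omega
      refine ⟨max 1 (max M ε⁻¹), ?_⟩
      filter_upwards [eventually_gt_atTop 0, eventually_ge_atTop b₁, eventually_ge_atTop b₂]
        with b hb hb₁ hb₂ s y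
      refine ⟨fun hsy => ?_, fun hs hy => ?_⟩
      · rw [hψ, if_neg hi]
        split_ifs with hbs
        · exact (div_self_le_one _).trans (le_max_left _ _)
        · have hs : s ≤ 1 := by
            by_contra! h
            exact hbs (by nlinarith)
          rw [hin]
          exact (h2 b hb₂ s y hs (by linarith [hsy hin])).trans
            ((le_max_left _ _).trans (le_max_right _ _))
      · have hbs : ¬ b < b * s := by nlinarith
        rw [hψ, if_neg hbs, if_neg hi]
        obtain ⟨hu, hv, huv⟩ := pos_and_le_of_le_div_mul hε (hFbar_pos b) (hf_nonneg _)
          (h1 b hb₁ s y (by simpa using hs) hy)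
        exact ((div_le_iff₀ hv).2 huv).trans (mul_le_mul_of_nonneg_right
          ((le_max_right _ _).trans (le_max_right _ _)) (hFbar_pos b).le)
  choose K hK using hfactor
  obtain ⟨b₀, hb₀⟩ := eventually_atTop.1 (eventually_all.2 hK)
  refine ⟨∏ i, K i, b₀, fun b hb y hy => ?_⟩
  obtain ⟨k, hk, hle, hjump⟩ := exists_large_jump ha (hS0 y) hy
  set j : Fin n := ⟨k, hk⟩ with hj
  have hyj : a * (1 - S y j) < y j := by
    have := hSsucc y j
    simp only [hj] at this ⊢
    linarith
  have hprod : ∏ i : Fin n, f (b * y i) / ψ ((i : ℕ) + 1) b (b * S y (i : ℕ)) (b * y i) ≤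
      ∏ i : Fin n, K i * (if i = j then Fbar b else 1) := by
    refine Finset.prod_le_prod
      (fun i _ => div_nonneg (hf_nonneg _) (hψ_nonneg _ _ _ _ (by omega))) fun i _ => ?_
    split_ifs with hij
    · subst hij
      exact (hb₀ b hb _ _ _).2 hle hyj
    · rw [mul_one]
      refine (hb₀ b hb i _ _).1 fun hin => ?_
      rwa [← hSsucc, hin]
  rw [Finset.prod_mul_distrib, Finset.prod_ite_eq' Finset.univ j,
    if_pos (Finset.mem_univ j)] at hprod
  rw [hR, inv_mul_eq_div, div_le_iff₀ (hFbar_pos b)]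
  exact hprod
end

section
/- Suppose there exists a ∈ (0,1) such that: (3.1) for each 1 ≤ i ≤ n, liminf_{b→∞} inf { (g_i^b(by | bs)/f(by))·F̄(b) : s ≤ 1−(1−a)^{i−1}, y > a(1−s) } > 0; (3.2) limsup_{b→∞} sup { f(by)/g_n^b(by | bs) : s ≤ 1, y > 1−s } < ∞; and (3.3) for each 1 ≤ i ≤ n there is a continuous function h_i : ℝ² → [0,∞) such that f(b y)/(g_i^b(b y | b s)·F̄(b)) → h_i(y | s) as b → ∞, uniformly over {(s,y) : s ≤ 1−(1−a)^{i−1}, y > a(1−s)}. Then limsup_{b→∞} E p̂_b² / p_b² ≤ (1/n²) · Σ_{i=1}^n (∏_{j=1}^{i−1} 1/p_j) · (1/q_i) · ∫_1^∞ h_i(y | 0) α y^{−α−1} dy, with the convention q_n = 1. -/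
open MeasureTheory Filter Set Real

/-- The tail of a density which is regularly varying with index `-α - 1` is regularly varying
with index `-α`. -/
lemma tendsto_tail_ratio {f : ℝ → ℝ} {α : ℝ} (hf : Integrable f) (hf_nonneg : ∀ x, 0 ≤ f x)
    (hf_rv : ∀ x : ℝ, 0 < x → Tendsto (fun u => f (u * x) / f u) atTop (nhds (x ^ (-α - 1))))
    (hpos : ∀ b, 0 < ∫ t in Ioi b, f t) {x : ℝ} (hx : 0 < x) :
    Tendsto (fun b => (∫ t in Ioi (b * x), f t) / ∫ t in Ioi b, f t) atTop
      (nhds (x ^ (-α))) := by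
  have hc : 0 < x ^ (-α - 1) := rpow_pos_of_pos hx _
  have hxc : x * x ^ (-α - 1) = x ^ (-α) := by
    rw [rpow_sub_one hx.ne']
    field_simp
  rw [Metric.tendsto_atTop]
  intro ε hε
  set η := min (ε / (2 * x)) (x ^ (-α - 1) / 2) with hη
  have hη0 : 0 < η := by positivity
  obtain ⟨u₀, hu₀⟩ := Metric.tendsto_atTop.1 (hf_rv x hx) η hη0
  refine ⟨u₀, fun b hb => ?_⟩
  have hscale : ∫ t in Ioi (b * x), f t = x * ∫ t in Ioi b, f (x * t) := by
    have := integral_comp_mul_left_Ioi f b hx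
    rw [this, smul_eq_mul, ← mul_assoc, mul_inv_cancel₀ hx.ne', one_mul, mul_comm b x]
  have hint : IntegrableOn (fun t => f (x * t)) (Ioi b) := (hf.comp_mul_left' hx.ne').integrableOn
  have hb_near : ∀ t ∈ Ioi b, |f (x * t) - x ^ (-α - 1) * f t| ≤ η * f t := by
    intro t ht
    have h1 := hu₀ t (hb.trans (le_of_lt ht))
    rw [Real.dist_eq, mul_comm t x] at h1
    have hft : f t ≠ 0 := by
      intro h0
      rw [h0, div_zero, zero_sub, abs_neg, abs_of_pos hc] at h1
      have := min_le_right (ε / (2 * x)) (x ^ (-α - 1) / 2)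
      linarith
    have hft' : 0 < f t := lt_of_le_of_ne (hf_nonneg t) hft.symm
    have h2 : f (x * t) - x ^ (-α - 1) * f t = (f (x * t) / f t - x ^ (-α - 1)) * f t := by
      field_simp
    rw [h2, abs_mul, abs_of_pos hft']
    gcongr
  have hdiff : |(∫ t in Ioi b, f (x * t)) - x ^ (-α - 1) * ∫ t in Ioi b, f t| ≤
      η * ∫ t in Ioi b, f t := by
    rw [← integral_const_mul, ← integral_sub hint (hf.integrableOn.const_mul _),
      ← integral_const_mul]
    refine (abs_integral_le_integral_abs).trans ?_
    exact setIntegral_mono_on ((hint.sub (hf.integrableOn.const_mul _)).abs)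
      (hf.integrableOn.const_mul _) measurableSet_Ioi hb_near
  have hT := hpos b
  rw [Real.dist_eq, hscale, ← hxc]
  have h3 : (x * ∫ t in Ioi b, f (x * t)) / (∫ t in Ioi b, f t) - x * x ^ (-α - 1) =
      x * ((∫ t in Ioi b, f (x * t)) - x ^ (-α - 1) * ∫ t in Ioi b, f t) /
        ∫ t in Ioi b, f t := by
    field_simp
  rw [h3, abs_div, abs_mul, abs_of_pos hx, abs_of_pos hT, div_lt_iff₀ hT]
  have h4 : x * η ≤ ε / 2 := by
    calc x * η ≤ x * (ε / (2 * x)) := by gcongr; exact min_le_left _ _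
      _ = ε / 2 := by field_simp
  calc _ ≤ x * (η * ∫ t in Ioi b, f t) := by gcongr
    _ = (x * η) * ∫ t in Ioi b, f t := by ring
    _ < _ := by gcongr; linarith

/-- Densities whose tails converge pointwise converge weakly. -/
lemma tendsto_integral_mul_of_tendsto_tail {ι : Type*} {l : Filter ι} [l.IsCountablyGenerated]
    {ρ : ι → ℝ → ℝ} {ρ' : ℝ → ℝ}
    (hρ : ∀ i x, 0 ≤ ρ i x) (hρ' : ∀ x, 0 ≤ ρ' x)
    (hρ_one : ∀ i, ∫ x, ρ i x = 1) (hρ'_one : ∫ x, ρ' x = 1)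
    (htail : ∀ y, Tendsto (fun i => ∫ x in Ioi y, ρ i x) l (nhds (∫ x in Ioi y, ρ' x)))
    {H : ℝ → ℝ} (hH : Continuous H) {C : ℝ} (hC : ∀ x, |H x| ≤ C) :
    Tendsto (fun i => ∫ x, H x * ρ i x) l (nhds (∫ x, H x * ρ' x)) := by
  have hint : ∀ {φ : ℝ → ℝ}, ∫ x, φ x = 1 → Integrable φ := fun {φ} h1 =>
    not_imp_comm.1 integral_undef (by rw [h1]; exact one_ne_zero)
  let m : (ℝ → ℝ) → Measure ℝ := fun φ => volume.withDensity fun x => ENNReal.ofReal (φ x)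
  have hm : ∀ {φ : ℝ → ℝ}, (∀ x, 0 ≤ φ x) → ∫ x, φ x = 1 → IsProbabilityMeasure (m φ) := by
    intro φ h0 h1
    refine ⟨?_⟩
    rw [withDensity_apply _ MeasurableSet.univ, Measure.restrict_univ,
      ← ofReal_integral_eq_lintegral_ofReal (hint h1) (ae_of_all _ h0), h1, ENNReal.ofReal_one]
  have hreal : ∀ {φ : ℝ → ℝ}, (∀ x, 0 ≤ φ x) → ∫ x, φ x = 1 → ∀ {s : Set ℝ}, MeasurableSet s →
      (m φ).real s = ∫ x in s, φ x := by
    intro φ h0 h1 s hs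
    rw [measureReal_def, withDensity_apply _ hs,
      ← ofReal_integral_eq_lintegral_ofReal (hint h1).integrableOn (ae_of_all _ h0),
      ENNReal.toReal_ofReal (integral_nonneg h0)]
  have hmul : ∀ {φ : ℝ → ℝ}, (∀ x, 0 ≤ φ x) → ∫ x, φ x = 1 →
      ∫ x, H x ∂(m φ) = ∫ x, H x * φ x := by
    intro φ h0 h1
    rw [integral_withDensity_eq_integral_toReal_smul₀ (hint h1).1.aemeasurable.ennreal_ofReal
      (by simp)]
    refine integral_congr_ae (ae_of_all _ fun x => ?_)
    simp [ENNReal.toReal_ofReal (h0 x), mul_comm]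
  have hIoc : ∀ {φ : ℝ → ℝ}, ∫ x, φ x = 1 → ∀ {u v : ℝ}, u ≤ v →
      ∫ x in Ioc u v, φ x = (∫ x in Ioi u, φ x) - ∫ x in Ioi v, φ x := by
    intro φ h1 u v huv
    rw [← Ioc_union_Ioi_eq_Ioi huv, setIntegral_union Ioc_disjoint_Ioi_same measurableSet_Ioi
      (hint h1).integrableOn (hint h1).integrableOn]
    ring
  let P : ι → ProbabilityMeasure ℝ := fun i => ⟨m (ρ i), hm (hρ i) (hρ_one i)⟩
  let P' : ProbabilityMeasure ℝ := ⟨m ρ', hm hρ' hρ'_one⟩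
  have hweak : Tendsto P l (nhds P') := by
    refine IsPiSystem.tendsto_probabilityMeasure_of_tendsto_of_mem
      (S := {s | ∃ u v : ℝ, u < v ∧ Ioc u v = s}) (isPiSystem_Ioc id id) ?_ ?_ ?_
    · rintro s ⟨u, v, -, rfl⟩
      exact measurableSet_Ioc
    · intro U hU x hx
      obtain ⟨ε, hε, hball⟩ := Metric.isOpen_iff.1 hU x hx
      refine ⟨Ioc (x - ε / 2) (x + ε / 2), ⟨_, _, by linarith, rfl⟩,
        Ioc_mem_nhds (by linarith) (by linarith), fun y hy => hball ?_⟩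
      rw [Metric.mem_ball, Real.dist_eq, abs_lt]
      constructor <;> linarith [hy.1, hy.2]
    · rintro s ⟨u, v, huv, rfl⟩
      rw [← NNReal.tendsto_coe]
      have h1 : ∀ i, ((P i (Ioc u v) : NNReal) : ℝ) =
          (∫ x in Ioi u, ρ i x) - ∫ x in Ioi v, ρ i x := fun i =>
        (hreal (hρ i) (hρ_one i) measurableSet_Ioc).trans (hIoc (hρ_one i) huv.le)
      have h2 : ((P' (Ioc u v) : NNReal) : ℝ) =
          (∫ x in Ioi u, ρ' x) - ∫ x in Ioi v, ρ' x :=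
        (hreal hρ' hρ'_one measurableSet_Ioc).trans (hIoc hρ'_one huv.le)
      simp_rw [h1, h2]
      exact (htail u).sub (htail v)
  have h3 := (ProbabilityMeasure.tendsto_iff_forall_integral_tendsto.1 hweak)
    (BoundedContinuousFunction.ofNormedAddCommGroup H hH C hC)
  have h4 : ∀ i, ∫ x, H x ∂(P i : Measure ℝ) = ∫ x, H x * ρ i x :=
    fun i => hmul (hρ i) (hρ_one i)
  have h5 : ∫ x, H x ∂(P' : Measure ℝ) = ∫ x, H x * ρ' x := hmul hρ' hρ'_one
  simpa [h4, h5] using h3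

/-- Conditionally on exceeding `b`, a random variable with regularly varying density, rescaled by
`b`, converges weakly to a Pareto distribution as `b → ∞`. -/
lemma tendsto_scaled_tail_integral {f : ℝ → ℝ} {α : ℝ} (hα : 0 < α) (hf : Integrable f)
    (hf_nonneg : ∀ x, 0 ≤ f x)
    (hf_rv : ∀ x : ℝ, 0 < x → Tendsto (fun u => f (u * x) / f u) atTop (nhds (x ^ (-α - 1))))
    (hpos : ∀ b, 0 < ∫ t in Ioi b, f t)
    {H : ℝ → ℝ} (hH : Continuous H) {C : ℝ} (hC : ∀ y, 1 ≤ y → |H y| ≤ C) :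
    Tendsto (fun b => (∫ t in Ioi b, H (t / b) * f t) / ∫ t in Ioi b, f t) atTop
      (nhds (∫ y in Ioi (1 : ℝ), H y * (α * y ^ (-α - 1)))) := by
  let c : ℝ → ℝ := fun b => max b 1
  have hc : ∀ b, 0 < c b := fun b => lt_max_of_lt_right one_pos
  let ρ : ℝ → ℝ → ℝ := fun b =>
    (Ioi (1 : ℝ)).indicator fun y => c b * f (c b * y) / ∫ t in Ioi (c b), f t
  let ρ' : ℝ → ℝ := (Ioi (1 : ℝ)).indicator fun y => α * y ^ (-α - 1)
  have hρ : ∀ b x, 0 ≤ ρ b x := fun b => indicator_nonneg fun y _ =>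
    div_nonneg (mul_nonneg (hc b).le (hf_nonneg _)) (hpos _).le
  have hρ' : ∀ x, 0 ≤ ρ' x := indicator_nonneg fun y hy =>
    mul_nonneg hα.le (rpow_nonneg (one_pos.trans hy).le _)
  have hscale : ∀ b y, ∫ t in Ioi y, c b * f (c b * t) / ∫ t in Ioi (c b), f t =
      (∫ t in Ioi (c b * y), f t) / ∫ t in Ioi (c b), f t := by
    intro b y
    rw [integral_div, integral_const_mul, integral_comp_mul_left_Ioi f y (hc b), smul_eq_mul,
      mul_inv_cancel_left₀ (hc b).ne']
  have hpareto : ∀ y, 0 < y → ∫ t in Ioi y, α * t ^ (-α - 1) = y ^ (-α) := by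
    intro y hy
    rw [integral_const_mul, integral_Ioi_rpow_of_lt (by linarith) hy]
    have : -α - 1 + 1 = -α := by ring
    rw [this]
    field_simp
  have hρ_one : ∀ b, ∫ x, ρ b x = 1 := by
    intro b
    rw [integral_indicator measurableSet_Ioi, hscale, mul_one, div_self (hpos _).ne']
  have hρ'_one : ∫ x, ρ' x = 1 := by
    rw [integral_indicator measurableSet_Ioi, hpareto 1 one_pos, one_rpow]
  have hceq : ∀ᶠ b in atTop, c b = b := by
    filter_upwards [eventually_ge_atTop (1 : ℝ)] with b hb using max_eq_left hb
  have htail : ∀ y, Tendsto (fun b => ∫ x in Ioi y, ρ b x) atTop (nhds (∫ x in Ioi y, ρ' x)) := by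
    intro y
    have hy : 0 < y ⊔ 1 := lt_max_of_lt_right one_pos
    have h1 : ∀ b, ∫ x in Ioi y, ρ b x =
        (∫ t in Ioi (c b * (y ⊔ 1)), f t) / ∫ t in Ioi (c b), f t := by
      intro b
      rw [setIntegral_indicator measurableSet_Ioi, Ioi_inter_Ioi, hscale]
    have h2 : ∫ x in Ioi y, ρ' x = (y ⊔ 1) ^ (-α) := by
      rw [setIntegral_indicator measurableSet_Ioi, Ioi_inter_Ioi, hpareto _ hy]
    simp_rw [h1, h2]
    refine (tendsto_tail_ratio hf hf_nonneg hf_rv hpos hy).congr' ?_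
    filter_upwards [hceq] with b hb
    rw [hb]
  have key := tendsto_integral_mul_of_tendsto_tail hρ hρ' hρ_one hρ'_one htail
    (H := fun y => H (max y 1)) (by fun_prop) (fun y => hC _ (le_max_right y 1))
  have hlim : ∫ y, H (max y 1) * ρ' y = ∫ y in Ioi (1 : ℝ), H y * (α * y ^ (-α - 1)) := by
    rw [← integral_indicator measurableSet_Ioi]
    congr 1 with y
    by_cases hy : y ∈ Ioi (1 : ℝ)
    · simp [ρ', hy, max_eq_left (le_of_lt (mem_Ioi.1 hy))]
    · simp [ρ', hy]
  rw [hlim] at key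
  refine key.congr' ?_
  filter_upwards [hceq] with b hb
  have hb0 : 0 < b := hb ▸ hc b
  have h3 : ∫ y, H (max y 1) * ρ b y =
      ∫ y in Ioi (1 : ℝ), b * (H (b * y / b) * f (b * y)) / ∫ t in Ioi b, f t := by
    rw [← integral_indicator measurableSet_Ioi]
    congr 1 with y
    by_cases hy : y ∈ Ioi (1 : ℝ)
    · simp only [ρ, hy, indicator_of_mem, max_eq_left (le_of_lt (mem_Ioi.1 hy)), hb,
        mul_div_cancel_left₀ y hb0.ne']
      ring
    · simp [ρ, hy]
  rw [h3, integral_div, integral_const_mul,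
    integral_comp_mul_left_Ioi (fun t => H (t / b) * f t) 1 hb0, smul_eq_mul,
    mul_inv_cancel_left₀ hb0.ne', mul_one]

section ProductDensity

variable {ι : Type*} [Fintype ι]

lemma integrable_prod_mul_prod {f : ℝ → ℝ} {w : ι → ℝ → ℝ}
    (hw : ∀ j, Integrable fun t => f t * w j t) :
    Integrable fun x : ι → ℝ => (∏ j, f (x j)) * ∏ j, w j (x j) := by
  simp_rw [← Finset.prod_mul_distrib]
  exact Integrable.fintype_prod hw

lemma integral_prod_mul_prod (f : ℝ → ℝ) (w : ι → ℝ → ℝ) :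
    ∫ x : ι → ℝ, (∏ j, f (x j)) * ∏ j, w j (x j) = ∏ j, ∫ t, f t * w j t := by
  simp_rw [← Finset.prod_mul_distrib]
  exact integral_fintype_prod_volume_eq_prod fun j t => f t * w j t

variable [DecidableEq ι] {f : ℝ → ℝ}

lemma integrable_prod_mul_apply (hf : Integrable f) {G : ℝ → ℝ}
    (hG : Integrable fun t => f t * G t) (k : ι) :
    Integrable fun x : ι → ℝ => (∏ j, f (x j)) * G (x k) := by
  have := integrable_prod_mul_prod (f := f) (w := fun j t => if j = k then G t else 1) fun j => by
    by_cases hj : j = k <;> simp [hj, hf, hG]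
  simpa using this

lemma integral_prod_mul_apply (hf_one : ∫ t, f t = 1) (G : ℝ → ℝ) (k : ι) :
    ∫ x : ι → ℝ, (∏ j, f (x j)) * G (x k) = ∫ t, f t * G t := by
  have h1 := integral_prod_mul_prod f fun (j : ι) t => if j = k then G t else 1
  have h2 : ∀ j, (∫ t, f t * if j = k then G t else 1) = if j = k then ∫ t, f t * G t else 1 := by
    intro j
    by_cases hj : j = k <;> simp [hj, hf_one]
  simpa only [h2, Finset.prod_ite_eq', Finset.mem_univ, if_true] using h1

lemma integrable_prod_mul_apply_mul_apply (hf : Integrable f) {G K : ℝ → ℝ}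
    (hG : Integrable fun t => f t * G t) (hK : Integrable fun t => f t * K t) {k l : ι}
    (hkl : l ≠ k) :
    Integrable fun x : ι → ℝ => (∏ j, f (x j)) * (G (x k) * K (x l)) := by
  have := integrable_prod_mul_prod (f := f)
    (w := fun j t => (if j = k then G t else 1) * if j = l then K t else 1) fun j => by
    by_cases hj : j = k
    · subst hj
      simp [hkl.symm, hG]
    · by_cases hj' : j = l <;> simp [hj, hj', hf]
      simpa [hkl] using hK
  simpa only [Finset.prod_mul_distrib, Finset.prod_ite_eq', Finset.mem_univ, if_true] using this

lemma integral_prod_mul_apply_mul_apply (hf_one : ∫ t, f t = 1) (G K : ℝ → ℝ) {k l : ι}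
    (hkl : l ≠ k) :
    ∫ x : ι → ℝ, (∏ j, f (x j)) * (G (x k) * K (x l)) =
      (∫ t, f t * G t) * ∫ t, f t * K t := by
  have h1 := integral_prod_mul_prod f
    fun (j : ι) t => (if j = k then G t else 1) * if j = l then K t else 1
  have h2 : ∀ j, (∫ t, f t * ((if j = k then G t else 1) * if j = l then K t else 1)) =
      (if j = k then ∫ t, f t * G t else 1) * if j = l then ∫ t, f t * K t else 1 := by
    intro j
    by_cases hj : j = k
    · subst hj
      simp [hkl.symm]
    · by_cases hj' : j = l
      · subst hj'
        simp [hj]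
      · simp [hj, hj', hf_one]
  simpa only [h2, Finset.prod_mul_distrib, Finset.prod_ite_eq', Finset.mem_univ, if_true] using h1

end ProductDensity

lemma integral_mul_indicator_one (f : ℝ → ℝ) {s : Set ℝ} (hs : MeasurableSet s) :
    ∫ t, f t * s.indicator 1 t = ∫ t in s, f t := by
  rw [← integral_indicator hs]
  congr 1 with t
  by_cases ht : t ∈ s <;> simp [ht]

lemma MeasureTheory.Integrable.mul_indicator_one {f : ℝ → ℝ} (hf : Integrable f) {s : Set ℝ}
    (hs : MeasurableSet s) : Integrable fun t => f t * s.indicator 1 t := by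
  refine (hf.indicator hs).congr (ae_of_all _ fun t => ?_)
  by_cases ht : t ∈ s <;> simp [ht]

lemma measurableSet_lt_abs (u : ℝ) : MeasurableSet {t : ℝ | u < |t|} :=
  measurableSet_lt measurable_const measurable_id.abs

lemma tendsto_setIntegral_lt_abs {f : ℝ → ℝ} (hf : Integrable f) :
    Tendsto (fun u : ℝ => ∫ t in {t : ℝ | u < |t|}, f t) atTop (nhds 0) := by
  simp_rw [← integral_indicator (measurableSet_lt_abs _)]
  have : ∫ _ : ℝ, (0 : ℝ) = 0 := integral_zero _ _
  rw [← this]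
  refine tendsto_integral_filter_of_dominated_convergence (fun t => |f t|)
    (Eventually.of_forall fun u => (hf.indicator (measurableSet_lt_abs u)).1)
    (Eventually.of_forall fun u => ae_of_all _ fun t => norm_indicator_le_norm_self _ _)
    hf.abs (ae_of_all _ fun t => ?_)
  refine tendsto_const_nhds.congr' ?_
  filter_upwards [eventually_ge_atTop |t|] with u hu
  simp [hu]

lemma abs_sum_le_of_forall_abs_le {n : ℕ} {x : Fin n → ℝ} {k : Fin n} {r : ℝ} (hr : 0 ≤ r)
    (hx : ∀ j, j ≠ k → |x j| ≤ r) {s : Finset (Fin n)} (hs : k ∉ s) :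
    |∑ j ∈ s, x j| ≤ n * r := by
  calc |∑ j ∈ s, x j| ≤ ∑ j ∈ s, |x j| := Finset.abs_sum_le_sum_abs _ _
    _ ≤ ∑ _j ∈ s, r := Finset.sum_le_sum fun j hj => hx j (ne_of_mem_of_not_mem hj hs)
    _ = s.card * r := by simp
    _ ≤ n * r := by
      gcongr
      simpa using Finset.card_le_univ s

lemma tendsto_rpow_one_add_mul (c β : ℝ) :
    Tendsto (fun δ : ℝ => (1 + c * δ) ^ β) (nhdsWithin 0 (Ioi 0)) (nhds 1) := by
  have h1 : ContinuousAt (fun δ : ℝ => (1 + c * δ) ^ β) 0 :=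
    ContinuousAt.rpow_const (by fun_prop) (Or.inl (by simp))
  simpa [ContinuousAt] using h1.tendsto.mono_left nhdsWithin_le_nhds

/-- The probability that a sum of `n` heavy-tailed variables is large is asymptotically at least
`n` times the tail of a single one. -/
lemma eventually_mul_tail_le_tail_sum {f : ℝ → ℝ} {α : ℝ} (hf_nonneg : ∀ x, 0 ≤ f x)
    (hf_one : ∫ x, f x = 1)
    (hf_rv : ∀ x : ℝ, 0 < x → Tendsto (fun u => f (u * x) / f u) atTop (nhds (x ^ (-α - 1))))
    (hpos : ∀ b, 0 < ∫ t in Ioi b, f t) (n : ℕ) {η : ℝ} (hη : 0 < η) :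
    ∀ᶠ b in atTop, n * (1 - η) * (∫ t in Ioi b, f t) ≤
      ∫ x in {x : Fin n → ℝ | b < ∑ j, x j}, ∏ j, f (x j) := by
  have hf : Integrable f := not_imp_comm.1 integral_undef (by rw [hf_one]; exact one_ne_zero)
  obtain ⟨δ, hδη, hδ⟩ := (((tendsto_rpow_one_add_mul n (-α)).eventually
    (lt_mem_nhds (show 1 - η < 1 by linarith))).and self_mem_nhdsWithin).exists
  have hnδ : 0 < 1 + n * δ := by positivity
  have hsmall : Tendsto (fun b : ℝ => 1 - ∫ t in {t : ℝ | δ * b < |t|}, f t) atTop (nhds 1) := by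
    simpa using ((tendsto_setIntegral_lt_abs hf).comp
      (tendsto_id.const_mul_atTop hδ)).const_sub 1
  have hlim := (tendsto_tail_ratio hf hf_nonneg hf_rv hpos hnδ).mul (hsmall.pow (n - 1))
  rw [one_pow, mul_one] at hlim
  filter_upwards [hlim.eventually (lt_mem_nhds hδη), eventually_gt_atTop 0] with b hb hb0
  set T := ∫ t in Ioi b, f t with hT
  let U : Set ℝ := Ioi (b * (1 + n * δ))
  let V : Set ℝ := {t : ℝ | δ * b < |t|}ᶜ
  have hV : MeasurableSet V := (measurableSet_lt_abs _).compl
  let w : Fin n → Fin n → ℝ → ℝ := fun k j => if j = k then U.indicator 1 else V.indicator 1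
  have hw_int : ∀ k j, Integrable fun t => f t * w k j t := by
    intro k j
    by_cases hj : j = k
    · simpa [w, hj] using hf.mul_indicator_one measurableSet_Ioi
    · simpa [w, hj] using hf.mul_indicator_one hV
  have hw : ∀ k, ∏ j, ∫ t, f t * w k j t =
      (∫ t in U, f t) * (1 - ∫ t in {t : ℝ | δ * b < |t|}, f t) ^ (n - 1) := by
    intro k
    have hVint : ∫ t in V, f t = 1 - ∫ t in {t : ℝ | δ * b < |t|}, f t := by
      rw [← hf_one, ← integral_add_compl (measurableSet_lt_abs _) hf]
      ring
    rw [← Finset.mul_prod_erase _ _ (Finset.mem_univ k), ← hVint]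
    congr 1
    · simp only [w, if_true]
      exact integral_mul_indicator_one f measurableSet_Ioi
    · rw [Finset.prod_congr rfl (g := fun _ => ∫ t in V, f t), Finset.prod_const]
      · simp
      · intro j hj
        simp only [w, if_neg (Finset.ne_of_mem_erase hj)]
        exact integral_mul_indicator_one f hV
  have hsum : ∫ x : Fin n → ℝ, ∑ k, (∏ j, f (x j)) * ∏ j, w k j (x j) =
      n * ((∫ t in U, f t) * (1 - ∫ t in {t : ℝ | δ * b < |t|}, f t) ^ (n - 1)) := by
    rw [integral_finsetSum _ fun k _ => integrable_prod_mul_prod (hw_int k)]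
    simp_rw [integral_prod_mul_prod, hw]
    simp
  have hmeas : MeasurableSet {x : Fin n → ℝ | b < ∑ j, x j} :=
    measurableSet_lt measurable_const
      (Finset.measurable_sum _ fun j _ => measurable_pi_apply j)
  have hw01 : ∀ k j t, 0 ≤ w k j t ∧ w k j t ≤ 1 := by
    intro k j t
    by_cases hj : j = k
    · by_cases ht : t ∈ U <;> simp [w, hj, ht]
    · by_cases ht : t ∈ V <;> simp [w, hj, ht]
  have hpt : ∀ x : Fin n → ℝ, ∑ k, ∏ j, w k j (x j) ≤
      {x : Fin n → ℝ | b < ∑ j, x j}.indicator 1 x := by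
    intro x
    by_cases hx : ∃ k, ∏ j, w k j (x j) ≠ 0
    · obtain ⟨k, hk⟩ := hx
      have hk' : ∀ j, w k j (x j) ≠ 0 := fun j => Finset.prod_ne_zero_iff.1 hk j (Finset.mem_univ j)
      have hxk : b * (1 + n * δ) < x k := by
        by_contra hcon
        exact hk' k (by simpa [w, U] using hcon)
      have hxj : ∀ j, j ≠ k → |x j| ≤ δ * b := by
        intro j hj
        by_contra hcon
        exact hk' j (by simpa [w, V, hj] using hcon)
      have hothers : ∀ l, l ≠ k → ∏ j, w l j (x j) = 0 := by
        intro l hl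
        refine Finset.prod_eq_zero (Finset.mem_univ l) ?_
        have : x l ≤ b * (1 + n * δ) := by
          have h1 := (le_abs_self _).trans (hxj l hl)
          have h2 : (1 : ℝ) ≤ n := by exact_mod_cast Fin.pos k
          have h3 : δ * b ≤ n * (δ * b) := le_mul_of_one_le_left (by positivity) h2
          nlinarith
        simpa [w, U] using this
      have hS : b < ∑ j, x j := by
        have h1 := abs_sum_le_of_forall_abs_le (by positivity) hxj
          (Finset.notMem_erase k Finset.univ)
        rw [← Finset.add_sum_erase _ _ (Finset.mem_univ k)]
        have h2 := (abs_le.1 h1).1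
        linarith
      rw [Finset.sum_eq_single k (fun l _ hl => hothers l hl) (by simp),
        indicator_of_mem (show x ∈ {x : Fin n → ℝ | b < ∑ j, x j} from hS)]
      exact Finset.prod_le_one (fun j _ => (hw01 k j _).1) fun j _ => (hw01 k j _).2
    · push Not at hx
      simp only [hx, Finset.sum_const_zero]
      exact indicator_nonneg (fun _ _ => zero_le_one) x
  have hprod_int : Integrable fun x : Fin n → ℝ => ∏ j, f (x j) :=
    Integrable.fintype_prod fun _ => hf
  have hle : n * ((∫ t in U, f t) * (1 - ∫ t in {t : ℝ | δ * b < |t|}, f t) ^ (n - 1)) ≤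
      ∫ x in {x : Fin n → ℝ | b < ∑ j, x j}, ∏ j, f (x j) := by
    rw [← hsum, ← integral_indicator hmeas]
    refine integral_mono (integrable_finsetSum _ fun k _ => integrable_prod_mul_prod (hw_int k))
      (hprod_int.indicator hmeas) fun x => ?_
    have h0 : 0 ≤ ∏ j, f (x j) := Finset.prod_nonneg fun j _ => hf_nonneg _
    have h1 := mul_le_mul_of_nonneg_left (hpt x) h0
    rw [Finset.mul_sum] at h1
    refine h1.trans (le_of_eq ?_)
    by_cases hx : x ∈ {x : Fin n → ℝ | b < ∑ j, x j} <;> simp [hx]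
  refine le_trans ?_ hle
  have hTpos : 0 < T := hpos b
  rw [div_mul_eq_mul_div, lt_div_iff₀ hTpos] at hb
  rw [mul_assoc]
  gcongr

/-- The weight that controls the likelihood ratio when one coordinate, equal to `t`, exceeds the
level `b` and all others are small. -/
noncomputable def bigJumpWeight (H : ℝ → ℝ) (A C D K ε r b t : ℝ) : ℝ :=
  A * ((Ioi b).indicator (fun t => H (t / b)) t + ε * (Ioi b).indicator 1 t) +
    A * C * (Ioi (b * K)).indicator 1 t + D * (Ioc (b * (1 - r)) (b * (1 + r))).indicator 1 t

lemma bigJumpWeight_nonneg {H : ℝ → ℝ} {A C D K ε r b : ℝ} (hA : 0 ≤ A) (hC : 0 ≤ C) (hD : 0 ≤ D)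
    (hε : 0 ≤ ε) (hH : ∀ y, 0 ≤ H y) (t : ℝ) : 0 ≤ bigJumpWeight H A C D K ε r b t := by
  have h1 : ∀ s : Set ℝ, 0 ≤ s.indicator (1 : ℝ → ℝ) t := fun s =>
    indicator_nonneg (fun _ _ => zero_le_one) t
  have h2 : 0 ≤ (Ioi b).indicator (fun t => H (t / b)) t := indicator_nonneg (fun _ _ => hH _) t
  have := h1 (Ioi b)
  have := h1 (Ioi (b * K))
  have := h1 (Ioc (b * (1 - r)) (b * (1 + r)))
  unfold bigJumpWeight
  positivity

section Majorant

variable {f : ℝ → ℝ} {α : ℝ} {n : ℕ}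

lemma integrable_mul_scaled_indicator (hf : Integrable f) {H : ℝ → ℝ} (hH : Continuous H)
    {C : ℝ} (hC : ∀ y, 1 ≤ y → |H y| ≤ C) {b : ℝ} (hb : 0 < b) :
    Integrable fun t => f t * (Ioi b).indicator (fun t => H (t / b)) t := by
  have h1 : Integrable fun t => (Ioi b).indicator (fun t => H (t / b)) t * f t := by
    refine hf.bdd_mul (c := C) ?_ (ae_of_all _ fun t => ?_)
    · exact ((hH.measurable.comp (measurable_id.div_const b)).indicator
        measurableSet_Ioi).aestronglyMeasurable
    · by_cases ht : t ∈ Ioi b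
      · rw [indicator_of_mem ht]
        exact hC _ ((one_le_div hb).2 (le_of_lt ht))
      · rw [indicator_of_notMem ht, norm_zero]
        exact (abs_nonneg _).trans (hC 1 le_rfl)
  simpa only [mul_comm] using h1

lemma integrable_mul_bigJumpWeight (hf : Integrable f) {H : ℝ → ℝ} (hH : Continuous H)
    {A C D K ε r b : ℝ} (hC : ∀ y, 1 ≤ y → |H y| ≤ C) (hb : 0 < b) :
    Integrable fun t => f t * bigJumpWeight H A C D K ε r b t := by
  have h1 := ((integrable_mul_scaled_indicator hf hH hC hb).const_mul A).add
    (((hf.mul_indicator_one (measurableSet_Ioi (a := b))).const_mul (A * ε)).add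
    (((hf.mul_indicator_one (measurableSet_Ioi (a := b * K))).const_mul (A * C)).add
    ((hf.mul_indicator_one
      (measurableSet_Ioc (a := b * (1 - r)) (b := b * (1 + r)))).const_mul D)))
  refine h1.congr (ae_of_all _ fun t => ?_)
  simp only [Pi.add_apply, bigJumpWeight]
  ring

lemma integral_mul_bigJumpWeight (hf : Integrable f) {H : ℝ → ℝ} (hH : Continuous H)
    {A C D K ε r b : ℝ} (hC : ∀ y, 1 ≤ y → |H y| ≤ C) (hb : 0 < b) (hr : 0 ≤ r) :
    ∫ t, f t * bigJumpWeight H A C D K ε r b t =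
      A * ((∫ t in Ioi b, H (t / b) * f t) + ε * ∫ t in Ioi b, f t) +
        A * C * (∫ t in Ioi (b * K), f t) +
        D * ((∫ t in Ioi (b * (1 - r)), f t) - ∫ t in Ioi (b * (1 + r)), f t) := by
  have i1 := (integrable_mul_scaled_indicator hf hH hC hb).const_mul A
  have i2 := (hf.mul_indicator_one (measurableSet_Ioi (a := b))).const_mul (A * ε)
  have i3 := (hf.mul_indicator_one (measurableSet_Ioi (a := b * K))).const_mul (A * C)
  have i4 := (hf.mul_indicator_one
      (measurableSet_Ioc (a := b * (1 - r)) (b := b * (1 + r)))).const_mul D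
  have i34 : Integrable fun t => A * C * (f t * (Ioi (b * K)).indicator 1 t) +
      D * (f t * (Ioc (b * (1 - r)) (b * (1 + r))).indicator 1 t) := i3.add i4
  have i234 : Integrable fun t => A * ε * (f t * (Ioi b).indicator 1 t) +
      (A * C * (f t * (Ioi (b * K)).indicator 1 t) +
      D * (f t * (Ioc (b * (1 - r)) (b * (1 + r))).indicator 1 t)) := i2.add i34
  have hle : b * (1 - r) ≤ b * (1 + r) := by gcongr; linarith
  have hH_int : ∫ t, f t * (Ioi b).indicator (fun t => H (t / b)) t =
      ∫ t in Ioi b, H (t / b) * f t := by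
    rw [← integral_indicator measurableSet_Ioi]
    congr 1 with t
    by_cases ht : t ∈ Ioi b <;> simp [ht, mul_comm]
  have hIoc : ∫ t in Ioc (b * (1 - r)) (b * (1 + r)), f t =
      (∫ t in Ioi (b * (1 - r)), f t) - ∫ t in Ioi (b * (1 + r)), f t := by
    rw [← Ioc_union_Ioi_eq_Ioi hle, setIntegral_union Ioc_disjoint_Ioi_same measurableSet_Ioi
      hf.integrableOn hf.integrableOn]
    ring
  calc ∫ t, f t * bigJumpWeight H A C D K ε r b t
      = ∫ t, (A * (f t * (Ioi b).indicator (fun t => H (t / b)) t) +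
          (A * ε * (f t * (Ioi b).indicator 1 t) +
          (A * C * (f t * (Ioi (b * K)).indicator 1 t) +
          D * (f t * (Ioc (b * (1 - r)) (b * (1 + r))).indicator 1 t)))) := by
        congr 1 with t
        simp only [bigJumpWeight]
        ring
    _ = _ := by
        rw [integral_add i1 i234, integral_add i2 i34, integral_add i3 i4,
          integral_const_mul, integral_const_mul, integral_const_mul, integral_const_mul, hH_int,
          integral_mul_indicator_one f measurableSet_Ioi,
          integral_mul_indicator_one f measurableSet_Ioi,
          integral_mul_indicator_one f measurableSet_Ioc, hIoc]
        ring

/-- The weight that controls the likelihood ratio when the coordinate `k` exceeds `b * c` and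
another coordinate exceeds `δ * b` in absolute value. -/
noncomputable def twoJumpWeight (k : Fin n) (c δ b : ℝ) (x : Fin n → ℝ) : ℝ :=
  ∑ j ∈ Finset.univ.erase k,
    (Ioi (b * c)).indicator 1 (x k) * {t : ℝ | δ * b < |t|}.indicator 1 (x j)

lemma twoJumpWeight_nonneg (k : Fin n) (c δ b : ℝ) (x : Fin n → ℝ) :
    0 ≤ twoJumpWeight k c δ b x :=
  Finset.sum_nonneg fun _ _ => mul_nonneg (indicator_nonneg (fun _ _ => zero_le_one) _)
    (indicator_nonneg (fun _ _ => zero_le_one) _)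

lemma one_le_twoJumpWeight {k j : Fin n} {c δ b : ℝ} {x : Fin n → ℝ} (hjk : j ≠ k)
    (hk : b * c < x k) (hj : δ * b < |x j|) : 1 ≤ twoJumpWeight k c δ b x := by
  have hterm : (Ioi (b * c)).indicator (1 : ℝ → ℝ) (x k) *
      {t : ℝ | δ * b < |t|}.indicator 1 (x j) = 1 := by
    simp [hk, hj]
  rw [← hterm]
  exact Finset.single_le_sum (f := fun j => (Ioi (b * c)).indicator (1 : ℝ → ℝ) (x k) *
      {t : ℝ | δ * b < |t|}.indicator 1 (x j))
    (fun _ _ => mul_nonneg (indicator_nonneg (fun _ _ => zero_le_one) _)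
      (indicator_nonneg (fun _ _ => zero_le_one) _))
    (Finset.mem_erase.2 ⟨hjk, Finset.mem_univ j⟩)

lemma integrable_prod_mul_twoJumpWeight (hf : Integrable f) (k : Fin n) (c δ b : ℝ) :
    Integrable fun x : Fin n → ℝ => (∏ j, f (x j)) * twoJumpWeight k c δ b x := by
  simp_rw [twoJumpWeight, Finset.mul_sum]
  exact integrable_finsetSum _ fun j hj => integrable_prod_mul_apply_mul_apply hf
    (hf.mul_indicator_one measurableSet_Ioi) (hf.mul_indicator_one (measurableSet_lt_abs _))
    (Finset.ne_of_mem_erase hj)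

lemma integral_prod_mul_twoJumpWeight (hf : Integrable f) (hf_one : ∫ t, f t = 1) (k : Fin n)
    (c δ b : ℝ) :
    ∫ x : Fin n → ℝ, (∏ j, f (x j)) * twoJumpWeight k c δ b x =
      (n - 1 : ℕ) * ((∫ t in Ioi (b * c), f t) * ∫ t in {t : ℝ | δ * b < |t|}, f t) := by
  simp_rw [twoJumpWeight, Finset.mul_sum]
  rw [integral_finsetSum _ fun j hj => integrable_prod_mul_apply_mul_apply hf
    (hf.mul_indicator_one measurableSet_Ioi) (hf.mul_indicator_one (measurableSet_lt_abs _))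
    (Finset.ne_of_mem_erase hj)]
  rw [Finset.sum_congr rfl fun j hj => integral_prod_mul_apply_mul_apply hf_one _ _
    (Finset.ne_of_mem_erase hj)]
  simp [integral_mul_indicator_one f measurableSet_Ioi,
    integral_mul_indicator_one f (measurableSet_lt_abs _)]

lemma tendsto_integral_prod_mul_weight_div (hα : 0 < α) (hf_nonneg : ∀ x, 0 ≤ f x)
    (hf_one : ∫ x, f x = 1)
    (hf_rv : ∀ x : ℝ, 0 < x → Tendsto (fun u => f (u * x) / f u) atTop (nhds (x ^ (-α - 1))))
    (hpos : ∀ b, 0 < ∫ t in Ioi b, f t) (k : Fin n) {H : ℝ → ℝ} (hH : Continuous H)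
    {A C D K ε r c δ : ℝ} (hC : ∀ y, 1 ≤ y → |H y| ≤ C) (hK : 0 < K) (hr0 : 0 ≤ r) (hr1 : r < 1)
    (hc : 0 < c) (hδ : 0 < δ) :
    Tendsto (fun b => (∫ x : Fin n → ℝ, (∏ j, f (x j)) *
        (bigJumpWeight H A C D K ε r b (x k) + D * twoJumpWeight k c δ b x)) /
        ∫ t in Ioi b, f t) atTop
      (nhds (A * ((∫ y in Ioi (1 : ℝ), H y * (α * y ^ (-α - 1))) + ε) + A * C * K ^ (-α) +
        D * ((1 - r) ^ (-α) - (1 + r) ^ (-α)))) := by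
  have hf : Integrable f := not_imp_comm.1 integral_undef (by rw [hf_one]; exact one_ne_zero)
  have t1 := tendsto_scaled_tail_integral hα hf hf_nonneg hf_rv hpos hH hC
  have t2 := tendsto_tail_ratio hf hf_nonneg hf_rv hpos hK
  have t3 := tendsto_tail_ratio hf hf_nonneg hf_rv hpos (show 0 < 1 - r by linarith)
  have t4 := tendsto_tail_ratio hf hf_nonneg hf_rv hpos (show 0 < 1 + r by linarith)
  have t5 := (tendsto_tail_ratio hf hf_nonneg hf_rv hpos hc).mul
    ((tendsto_setIntegral_lt_abs hf).comp (tendsto_id.const_mul_atTop hδ))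
  have hlim := ((((t1.add_const ε).const_mul A).add (t2.const_mul (A * C))).add
    ((t3.sub t4).const_mul D)).add (t5.const_mul (D * (n - 1 : ℕ)))
  rw [mul_zero, mul_zero, add_zero] at hlim
  refine hlim.congr' ?_
  filter_upwards [eventually_gt_atTop 0] with b hb
  have hT := (hpos b).ne'
  have i1 := integrable_prod_mul_apply hf
    (integrable_mul_bigJumpWeight (A := A) (C := C) (D := D) (K := K) (ε := ε) (r := r)
      hf hH hC hb) k
  have i2 := (integrable_prod_mul_twoJumpWeight hf k c δ b).const_mul D
  have hsplit : ∫ x : Fin n → ℝ, (∏ j, f (x j)) *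
      (bigJumpWeight H A C D K ε r b (x k) + D * twoJumpWeight k c δ b x) =
      (∫ t, f t * bigJumpWeight H A C D K ε r b t) +
        D * ((n - 1 : ℕ) *
          ((∫ t in Ioi (b * c), f t) * ∫ t in {t : ℝ | δ * b < |t|}, f t)) := by
    rw [← integral_prod_mul_twoJumpWeight hf hf_one, ← integral_const_mul,
      ← integral_prod_mul_apply hf_one _ k, ← integral_add i1 i2]
    congr 1 with x
    ring
  rw [hsplit, integral_mul_bigJumpWeight hf hH hC hb hr0]
  simp only [Function.comp_apply, id]
  field_simp

end Majorant

lemma exists_forall_le_add {h : ℝ → ℝ → ℝ} (hh : Continuous fun z : ℝ × ℝ => h z.1 z.2) (K : ℝ)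
    {ε : ℝ} (hε : 0 < ε) :
    ∃ δ > 0, ∀ y ∈ Icc 1 K, ∀ s, |s| ≤ δ → h y s ≤ h y 0 + ε := by
  have huc := ((isCompact_Icc (a := (1 : ℝ)) (b := K)).prod
    (isCompact_Icc (a := (-1 : ℝ)) (b := 1))).uniformContinuousOn_of_continuous hh.continuousOn
  obtain ⟨δ, hδ, hclose⟩ := Metric.uniformContinuousOn_iff.1 huc ε hε
  refine ⟨min (δ / 2) 1, by positivity, fun y hy s hs => ?_⟩
  have hs1 := abs_le.1 (hs.trans (min_le_right _ _))
  have hs2 := hs.trans (min_le_left _ _)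
  have h1 := hclose (y, s) ⟨hy, hs1⟩ (y, 0) ⟨hy, by simp⟩ (by
    simp only [Prod.dist_eq, dist_self, Real.dist_eq, sub_zero]
    exact max_lt hδ (by linarith))
  rw [Real.dist_eq] at h1
  linarith [(abs_lt.1 h1).2]

/-- The sum of the coordinates of `x` with index less than `m`. -/
noncomputable def prefixSum {n : ℕ} (x : Fin n → ℝ) (m : ℕ) : ℝ :=
  ∑ j ∈ Finset.univ.filter (fun j : Fin n => (j : ℕ) < m), x j

lemma prefixSum_zero {n : ℕ} (x : Fin n → ℝ) : prefixSum x 0 = 0 := by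
  simp [prefixSum]

lemma prefixSum_self {n : ℕ} (x : Fin n → ℝ) : prefixSum x n = ∑ j, x j := by
  simp [prefixSum]

lemma prefixSum_succ {n : ℕ} (x : Fin n → ℝ) (k : Fin n) :
    prefixSum x (k + 1) = prefixSum x k + x k := by
  have h1 : Finset.univ.filter (fun j : Fin n => (j : ℕ) < k + 1) =
      insert k (Finset.univ.filter fun j : Fin n => (j : ℕ) < k) := by
    ext j
    simp only [Finset.mem_filter, Finset.mem_univ, true_and, Finset.mem_insert, Fin.ext_iff]
    omega
  rw [prefixSum, h1, Finset.sum_insert (by simp), add_comm]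
  rfl

/-- An integrable majorant for a normalized likelihood ratio `L` on the event that the sum is
large because of the coordinate `k`. -/
lemma exists_majorant {f : ℝ → ℝ} {α : ℝ} {n : ℕ} (hα : 0 < α) (hf_nonneg : ∀ x, 0 ≤ f x)
    (hf_one : ∫ x, f x = 1)
    (hf_rv : ∀ x : ℝ, 0 < x → Tendsto (fun u => f (u * x) / f u) atTop (nhds (x ^ (-α - 1))))
    (hpos : ∀ b, 0 < ∫ t in Ioi b, f t) (k : Fin n) {h : ℝ → ℝ → ℝ}
    (hh : Continuous fun z : ℝ × ℝ => h z.1 z.2) (hh_nonneg : ∀ y s, 0 ≤ h y s)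
    {A C D c η : ℝ} (hA : 0 ≤ A) (hC0 : 0 ≤ C) (hD : 0 ≤ D) (hc : 0 < c)
    (hC : ∀ y, 1 ≤ y → h y 0 ≤ C) (hη : 0 < η) :
    ∃ ε > 0, ∃ δ > 0, ∀ᶠ b in atTop, ∃ W : (Fin n → ℝ) → ℝ, (∀ x, 0 ≤ W x) ∧
      (Integrable fun x : Fin n → ℝ => (∏ j, f (x j)) * W x) ∧
      (∫ x : Fin n → ℝ, (∏ j, f (x j)) * W x ≤
        (A * (∫ y in Ioi (1 : ℝ), h y 0 * (α * y ^ (-α - 1))) + η) * ∫ t in Ioi b, f t) ∧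
      ∀ (x : Fin n → ℝ) (L R : ℝ), b < ∑ j, x j → b * c < x k → L ≤ D →
        ((∀ j, j ≠ k → |x j| ≤ δ * b) → b * (1 + n * δ) < x k → L ≤ A * R) → R ≤ C →
        R ≤ h (x k / b) (prefixSum x k / b) + ε → L ≤ W x := by
  have hf : Integrable f := not_imp_comm.1 integral_undef (by rw [hf_one]; exact one_ne_zero)
  have hn : (0 : ℝ) < n := by exact_mod_cast Fin.pos k
  have hH : Continuous fun y => h y 0 := by fun_prop
  have hH_abs : ∀ y, 1 ≤ y → |h y 0| ≤ C := fun y hy => by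
    rw [abs_of_nonneg (hh_nonneg _ _)]
    exact hC y hy
  obtain ⟨ε, hε, hAε⟩ : ∃ ε > 0, A * (2 * ε) < η / 3 := by
    refine ⟨η / (6 * (A + 1)) / 2, by positivity, ?_⟩
    have : A * (2 * (η / (6 * (A + 1)) / 2)) = A / (A + 1) * (η / 6) := by
      field_simp
    rw [this]
    have h1 : A / (A + 1) ≤ 1 := (div_le_one (by positivity)).2 (by linarith)
    nlinarith
  obtain ⟨K, hK, hK1⟩ : ∃ K : ℝ, A * C * K ^ (-α) < η / 3 ∧ 1 < K := by
    have h1 := (tendsto_rpow_neg_atTop hα).const_mul (A * C)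
    rw [mul_zero] at h1
    exact ((h1.eventually (gt_mem_nhds (by positivity))).and (eventually_gt_atTop 1)).exists
  obtain ⟨δ₀, hδ₀, hclose⟩ := exists_forall_le_add hh K hε
  obtain ⟨δ, ⟨hDδ, hδ1, hδ2⟩, hδ⟩ : ∃ δ : ℝ,
      (D * ((1 - n * δ) ^ (-α) - (1 + n * δ) ^ (-α)) < η / 3 ∧ n * δ < 1 ∧ n * δ < δ₀) ∧
        0 < δ := by
    have h1 := ((tendsto_rpow_one_add_mul (-n) (-α)).sub
      (tendsto_rpow_one_add_mul n (-α))).const_mul D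
    simp only [sub_self, mul_zero, neg_mul, ← sub_eq_add_neg] at h1
    have h2 : Tendsto (fun δ : ℝ => n * δ) (nhdsWithin 0 (Ioi 0)) (nhds 0) := by
      have : ContinuousAt (fun δ : ℝ => n * δ) 0 := by fun_prop
      simpa [ContinuousAt] using this.tendsto.mono_left nhdsWithin_le_nhds
    exact (((h1.eventually (gt_mem_nhds (by positivity))).and
      ((h2.eventually (gt_mem_nhds one_pos)).and (h2.eventually (gt_mem_nhds hδ₀)))).and
      self_mem_nhdsWithin).exists
  have hr0 : 0 < n * δ := by positivity
  refine ⟨ε, hε, δ, hδ, ?_⟩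
  have hlim := tendsto_integral_prod_mul_weight_div (A := A) (D := D) (ε := 2 * ε) hα hf_nonneg
    hf_one hf_rv hpos k hH hH_abs (one_pos.trans hK1) hr0.le hδ1 hc hδ
  have hlt : A * ((∫ y in Ioi (1 : ℝ), h y 0 * (α * y ^ (-α - 1))) + 2 * ε) + A * C * K ^ (-α) +
      D * ((1 - n * δ) ^ (-α) - (1 + n * δ) ^ (-α)) <
      A * (∫ y in Ioi (1 : ℝ), h y 0 * (α * y ^ (-α - 1))) + η := by
    linarith
  filter_upwards [hlim.eventually (gt_mem_nhds hlt), eventually_gt_atTop 0] with b hb hb0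
  have hG := fun t => bigJumpWeight_nonneg (H := fun y => h y 0) (K := K) (ε := 2 * ε)
    (r := n * δ) (b := b) hA hC0 hD (by positivity) (fun y => hh_nonneg y 0) t
  refine ⟨fun x => bigJumpWeight (fun y => h y 0) A C D K (2 * ε) (n * δ) b (x k) +
    D * twoJumpWeight k c δ b x,
    fun x => add_nonneg (hG _) (mul_nonneg hD (twoJumpWeight_nonneg _ _ _ _ _)), ?_,
    ((div_lt_iff₀ (hpos b)).1 hb).le, ?_⟩
  · simp_rw [mul_add]
    refine (integrable_prod_mul_apply hf (integrable_mul_bigJumpWeight hf hH hH_abs hb0) k).add ?_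
    simpa only [mul_left_comm] using (integrable_prod_mul_twoJumpWeight hf k c δ b).const_mul D
  · intro x L R hS hxk hLD hgood hRC hRh
    by_cases hsmall : ∀ j, j ≠ k → |x j| ≤ δ * b
    · have hxk_lower : b * (1 - n * δ) < x k := by
        have h1 := abs_sum_le_of_forall_abs_le (by positivity) hsmall
          (Finset.notMem_erase k Finset.univ)
        rw [← Finset.add_sum_erase _ _ (Finset.mem_univ k)] at hS
        linarith [(abs_le.1 h1).2]
      refine le_add_of_le_of_nonneg ?_ (mul_nonneg hD (twoJumpWeight_nonneg _ _ _ _ _))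
      have hind : ∀ s : Set ℝ, 0 ≤ s.indicator (1 : ℝ → ℝ) (x k) := fun s =>
        indicator_nonneg (fun _ _ => zero_le_one) _
      by_cases hxk_upper : x k ≤ b * (1 + n * δ)
      · have h1 : (Ioc (b * (1 - n * δ)) (b * (1 + n * δ))).indicator (1 : ℝ → ℝ) (x k) = 1 :=
          indicator_of_mem (show x k ∈ Ioc _ _ from ⟨hxk_lower, hxk_upper⟩) _
        have h2 := hind (Ioi b)
        have h3 := hind (Ioi (b * K))
        have h4 : 0 ≤ (Ioi b).indicator (fun t => h (t / b) 0) (x k) :=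
          indicator_nonneg (fun _ _ => hh_nonneg _ _) _
        have h5 : 0 ≤ A * ((Ioi b).indicator (fun t => h (t / b) 0) (x k) +
            2 * ε * (Ioi b).indicator 1 (x k)) := by positivity
        have h6 : 0 ≤ A * C * (Ioi (b * K)).indicator 1 (x k) := by positivity
        rw [bigJumpWeight, h1]
        linarith
      · push Not at hxk_upper
        have hbx : b < x k := by nlinarith
        have hmem : x k ∈ Ioi b := hbx
        have hLR := hgood hsmall hxk_upper
        have h1 := hind (Ioc (b * (1 - n * δ)) (b * (1 + n * δ)))
        have h2 : R ≤ h (x k / b) 0 + 2 * ε + C * (Ioi (b * K)).indicator 1 (x k) := by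
          by_cases hKx : b * K < x k
          · rw [indicator_of_mem (show x k ∈ Ioi (b * K) from hKx), Pi.one_apply]
            linarith [hh_nonneg (x k / b) 0]
          · rw [indicator_of_notMem (by simpa using hKx)]
            have hy : x k / b ∈ Icc 1 K :=
              ⟨(one_le_div hb0).2 hbx.le, (div_le_iff₀ hb0).2 (by linarith)⟩
            have hs : |prefixSum x k / b| ≤ δ₀ := by
              have h1 := abs_sum_le_of_forall_abs_le (by positivity) hsmall
                (s := Finset.univ.filter fun j : Fin n => (j : ℕ) < k) (by simp)
              rw [abs_div, abs_of_pos hb0, div_le_iff₀ hb0, prefixSum]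
              nlinarith
            linarith [hclose _ hy _ hs]
        have h3 : A * R ≤ A * (h (x k / b) 0 + 2 * ε + C * (Ioi (b * K)).indicator 1 (x k)) := by
          gcongr
        have h4 := mul_nonneg hD h1
        rw [bigJumpWeight, indicator_of_mem hmem, indicator_of_mem hmem, Pi.one_apply]
        linarith
    · push Not at hsmall
      obtain ⟨j, hjk, hj⟩ := hsmall
      refine le_add_of_nonneg_of_le (hG _) (hLD.trans ?_)
      exact le_mul_of_one_le_right hD (one_le_twoJumpWeight hjk hxk hj)

/-- If a sum exceeds `b`, then some term exceeds the fraction `a` of the distance to `b` that is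
left by the preceding terms, while this distance is still comparable with `b`. -/
lemma exists_jump {n : ℕ} {a b : ℝ} (ha : a ∈ Ioo (0 : ℝ) 1) (hb : 0 < b) {x : Fin n → ℝ}
    (hx : b < ∑ j, x j) :
    ∃ k : Fin n, b * (1 - a) ^ (k : ℕ) ≤ b - prefixSum x k ∧ a * (b - prefixSum x k) < x k := by
  by_contra! hcon
  have hbound : ∀ m ≤ n, b * (1 - a) ^ m ≤ b - prefixSum x m := by
    intro m
    induction m with
    | zero => simp [prefixSum_zero]
    | succ m ih =>
      intro hm
      have h1 := ih (Nat.le_of_succ_le hm)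
      have h2 := hcon ⟨m, hm⟩ h1
      have h3 := prefixSum_succ x ⟨m, hm⟩
      simp only at h2 h3
      rw [h3, pow_succ]
      have h4 := mul_le_mul_of_nonneg_right h1 (sub_nonneg.2 ha.2.le)
      linarith
  have h1 := hbound n le_rfl
  rw [prefixSum_self] at h1
  have h2 : 0 < b * (1 - a) ^ n := mul_pos hb (pow_pos (sub_pos.2 ha.2) n)
  linarith

lemma prod_univ_ite_lt {n : ℕ} (d : ℕ → ℝ) (k : Fin n) :
    ∏ j : Fin n, (if (j : ℕ) < k then d j else 1) = ∏ j ∈ Finset.range k, d j := by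
  rw [Fin.prod_univ_eq_prod_range (fun j => if j < (k : ℕ) then d j else 1) n,
    ← Finset.prod_filter]
  congr 1
  ext j
  simp only [Finset.mem_filter, Finset.mem_range]
  omega

/-- Asymptotic bound for the integral of a product of likelihood ratios `r` over the event that a
heavy-tailed sum is large. Here `d` bounds the ratios in general, and `v * h` is the limit of the
ratio, relative to the tail, at the big jump. -/
lemma eventually_setIntegral_prod_mul_le {f : ℝ → ℝ} {α : ℝ} {n : ℕ} (hα : 0 < α)
    (hf_nonneg : ∀ x, 0 ≤ f x) (hf_one : ∫ x, f x = 1)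
    (hf_rv : ∀ x : ℝ, 0 < x → Tendsto (fun u => f (u * x) / f u) atTop (nhds (x ^ (-α - 1))))
    (hpos : ∀ b, 0 < ∫ t in Ioi b, f t) {a : ℝ} (ha : a ∈ Ioo (0 : ℝ) 1)
    {r : ℝ → (Fin n → ℝ) → Fin n → ℝ} {d : ℕ → ℝ} {v : Fin n → ℝ} {h : Fin n → ℝ → ℝ → ℝ}
    {C : Fin n → ℝ}
    (hh : ∀ k, Continuous fun z : ℝ × ℝ => h k z.1 z.2) (hh_nonneg : ∀ k y s, 0 ≤ h k y s)
    (hhC : ∀ k y, 1 ≤ y → h k y 0 ≤ C k)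
    (hd : ∀ j < n, 1 ≤ d j) (hv : ∀ k, 0 < v k) (hC : ∀ k, 0 ≤ C k)
    (hr_nonneg : ∀ b x j, 0 ≤ r b x j)
    (hr_le : ∀ᶠ b in atTop, ∀ x, b < ∑ j, x j → ∀ j, r b x j ≤ d j)
    (hr_one : ∀ b x (j : Fin n), b < prefixSum x j → r b x j ≤ 1)
    (hr_jump : ∀ k : Fin n, ∀ᶠ b in atTop, ∀ x : Fin n → ℝ,
      b * (1 - a) ^ (k : ℕ) ≤ b - prefixSum x k → a * (b - prefixSum x k) < x k →
      r b x k ≤ v k * (∫ t in Ioi b, f t) * C k)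
    (hr_lim : ∀ k : Fin n, ∀ ε > 0, ∀ᶠ b in atTop, ∀ x : Fin n → ℝ,
      b * (1 - a) ^ (k : ℕ) ≤ b - prefixSum x k → a * (b - prefixSum x k) < x k →
      r b x k ≤ v k * (∫ t in Ioi b, f t) * (h k (x k / b) (prefixSum x k / b) + ε))
    {η : ℝ} (hη : 0 < η) :
    ∀ᶠ b in atTop, ∫ x in {x : Fin n → ℝ | b < ∑ j, x j}, ∏ j, f (x j) * r b x j ≤
      (∫ t in Ioi b, f t) ^ 2 * ((∑ k : Fin n, (∏ j ∈ Finset.range k, d j) * v k *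
        ∫ y in Ioi (1 : ℝ), h k y 0 * (α * y ^ (-α - 1))) + n * η) := by
  have ha1 : 0 < 1 - a := sub_pos.2 ha.2
  have hd_prefix : ∀ k : Fin n, 0 ≤ ∏ j ∈ Finset.range k, d j := fun k =>
    Finset.prod_nonneg fun j hj =>
      zero_le_one.trans (hd j ((Finset.mem_range.1 hj).trans k.isLt))
  have hd0 : ∀ j : Fin n, 0 ≤ d j := fun j => zero_le_one.trans (hd j j.isLt)
  have hmaj := fun k : Fin n => exists_majorant hα hf_nonneg hf_one hf_rv hpos k (hh k)
    (hh_nonneg k) (A := (∏ j ∈ Finset.range k, d j) * v k) (C := C k)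
    (D := (∏ j : Fin n, d j) * v k * C k) (c := a * (1 - a) ^ (k : ℕ))
    (mul_nonneg (hd_prefix k) (hv k).le) (hC k)
    (mul_nonneg (mul_nonneg (Finset.prod_nonneg fun j _ => hd0 j) (hv k).le) (hC k))
    (mul_pos ha.1 (pow_pos ha1 _)) (hhC k) hη
  choose ε hε δ hδ hW using hmaj
  filter_upwards [eventually_all.2 hW, eventually_all.2 hr_jump, hr_le,
    eventually_all.2 fun k => hr_lim k (ε k) (hε k), eventually_gt_atTop 0]
    with b hWb hjump hle hlim hb
  set T := ∫ t in Ioi b, f t with hTdef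
  have hT : 0 < T := hpos b
  choose W hW0 hWint hWle hWdom using hWb
  have hdom : ∀ x : Fin n → ℝ, b < ∑ j, x j → ∏ j, r b x j ≤ T * ∑ k, W k x := by
    intro x hx
    obtain ⟨k, hk1, hk2⟩ := exists_jump ha hb hx
    have hvT : 0 < v k * T := mul_pos (hv k) hT
    have hLW : (∏ j, r b x j) / T ≤ W k x := by
      refine hWdom k x _ (r b x k / (v k * T)) hx ?_ ?_ ?_ ?_ ?_
      · have := mul_le_mul_of_nonneg_left hk1 ha.1.le
        linarith
      · rw [div_le_iff₀ hT, ← Finset.prod_erase_mul _ _ (Finset.mem_univ k)]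
        have h1 : ∏ j ∈ Finset.univ.erase k, r b x j ≤ ∏ j : Fin n, d j := by
          rw [← Finset.prod_erase_mul _ _ (Finset.mem_univ k)]
          refine (Finset.prod_le_prod (fun j _ => hr_nonneg b x j) fun j _ => hle x hx j).trans ?_
          exact le_mul_of_one_le_right (Finset.prod_nonneg fun j _ => hd0 j) (hd k k.isLt)
        calc _ ≤ (∏ j : Fin n, d j) * (v k * T * C k) := by
              refine mul_le_mul h1 (hjump k x hk1 hk2) (hr_nonneg b x k)
                (Finset.prod_nonneg fun j _ => hd0 j)
          _ = _ := by ring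
      · intro hsmall hbig
        have hafter : ∀ j : Fin n, k < j → b < prefixSum x j := by
          intro j hj
          have hmem : k ∈ Finset.univ.filter fun i : Fin n => (i : ℕ) < j := by simpa using hj
          have h1 := abs_sum_le_of_forall_abs_le (mul_nonneg (hδ k).le hb.le) hsmall
            (Finset.notMem_erase k (Finset.univ.filter fun i : Fin n => (i : ℕ) < j))
          rw [prefixSum, ← Finset.add_sum_erase _ _ hmem]
          linarith [(abs_le.1 h1).1]
        have h1 : ∏ j, r b x j ≤ (∏ j ∈ Finset.range k, d j) * r b x k := by
          calc ∏ j, r b x j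
              ≤ ∏ j : Fin n, (if (j : ℕ) < k then d j else 1) *
                  (if j = k then r b x j else 1) := by
                refine Finset.prod_le_prod (fun j _ => hr_nonneg b x j) fun j _ => ?_
                rcases lt_trichotomy j k with hj | rfl | hj
                · simpa [hj, hj.ne] using hle x hx j
                · simp
                · simpa [hj.not_gt, hj.ne'] using hr_one b x j (hafter j hj)
            _ = _ := by
                rw [Finset.prod_mul_distrib, prod_univ_ite_lt, Finset.prod_ite_eq']
                simp
        rw [div_le_iff₀ hT]
        refine h1.trans (le_of_eq ?_)
        have := (hv k).ne'
        field_simp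
      · rw [div_le_iff₀ hvT]
        linarith [hjump k x hk1 hk2]
      · rw [div_le_iff₀ hvT]
        have := hlim k x hk1 hk2
        linarith
    rw [div_le_iff₀ hT, mul_comm] at hLW
    refine hLW.trans (mul_le_mul_of_nonneg_left ?_ hT.le)
    exact Finset.single_le_sum (f := fun k => W k x) (fun k _ => hW0 k x) (Finset.mem_univ k)
  have hmeas : MeasurableSet {x : Fin n → ℝ | b < ∑ j, x j} :=
    measurableSet_lt measurable_const
      (Finset.measurable_sum _ fun j _ => measurable_pi_apply j)
  have hf_prod : ∀ x : Fin n → ℝ, 0 ≤ ∏ j, f (x j) := fun x =>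
    Finset.prod_nonneg fun j _ => hf_nonneg _
  have hint : Integrable fun x : Fin n → ℝ => T * ∑ k, (∏ j, f (x j)) * W k x :=
    (integrable_finsetSum _ fun k _ => hWint k).const_mul T
  calc ∫ x in {x : Fin n → ℝ | b < ∑ j, x j}, ∏ j, f (x j) * r b x j
      ≤ ∫ x in {x : Fin n → ℝ | b < ∑ j, x j}, T * ∑ k, (∏ j, f (x j)) * W k x := by
        refine integral_mono_of_nonneg (ae_of_all _ fun x =>
          Finset.prod_nonneg fun j _ => mul_nonneg (hf_nonneg _) (hr_nonneg b x j))
          hint.integrableOn (ae_restrict_of_forall_mem hmeas fun x hx => ?_)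
        simp only
        rw [Finset.prod_mul_distrib, ← Finset.mul_sum, mul_left_comm]
        exact mul_le_mul_of_nonneg_left (hdom x hx) (hf_prod x)
    _ ≤ ∫ x : Fin n → ℝ, T * ∑ k, (∏ j, f (x j)) * W k x :=
        setIntegral_le_integral hint (ae_of_all _ fun x => mul_nonneg hT.le
          (Finset.sum_nonneg fun k _ => mul_nonneg (hf_prod x) (hW0 k x)))
    _ = T * ∑ k, ∫ x : Fin n → ℝ, (∏ j, f (x j)) * W k x := by
        rw [integral_const_mul, integral_finsetSum _ fun k _ => hWint k]
    _ ≤ T * ∑ k : Fin n, ((∏ j ∈ Finset.range k, d j) * v k *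
          (∫ y in Ioi (1 : ℝ), h k y 0 * (α * y ^ (-α - 1))) + η) * T :=
        mul_le_mul_of_nonneg_left (Finset.sum_le_sum fun k _ => hWle k) hT.le
    _ = _ := by
        rw [← Finset.sum_mul, Finset.sum_add_distrib]
        simp only [Finset.sum_const, Finset.card_univ, Fintype.card_fin, nsmul_eq_mul]
        ring

lemma div_mixture_le_inv_left {p u w : ℝ} (hp : p ∈ Ioo (0 : ℝ) 1) (hu : 0 ≤ u) (hw : 0 ≤ w) :
    u / (p * u + (1 - p) * w) ≤ p⁻¹ := by
  have h1 := mul_nonneg hp.1.le hu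
  have h2 := mul_nonneg (sub_pos.2 hp.2).le hw
  refine div_le_of_le_mul₀ (add_nonneg h1 h2) (inv_nonneg.2 hp.1.le) ?_
  rw [mul_add, inv_mul_cancel_left₀ hp.1.ne']
  exact le_add_of_nonneg_right (mul_nonneg (inv_nonneg.2 hp.1.le) h2)

lemma div_mixture_le_mul_div {p u w : ℝ} (hp : p ∈ Ioo (0 : ℝ) 1) (hu : 0 ≤ u) (hw : 0 < w) :
    u / (p * u + (1 - p) * w) ≤ (1 - p)⁻¹ * (u / w) := by
  have h1 := sub_pos.2 hp.2
  rw [inv_mul_eq_div, div_div, mul_comm w]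
  exact div_le_div_of_nonneg_left hu (mul_pos h1 hw)
    (le_add_of_nonneg_left (mul_nonneg hp.1.le hu))

lemma exists_add_mul_div_sq_le (V : ℝ) {m ε : ℝ} (hm : 0 < m) (hε : 0 < ε) :
    ∃ η ∈ Ioo (0 : ℝ) 1, (V + m * η) / (m * (1 - η)) ^ 2 ≤ 1 / m ^ 2 * V + ε := by
  have h1 : ContinuousAt (fun η : ℝ => (V + m * η) / (m * (1 - η)) ^ 2) 0 := by
    refine ContinuousAt.div (by fun_prop) (by fun_prop) ?_
    simpa using hm.ne'
  have h2 : (V + m * 0) / (m * (1 - 0)) ^ 2 < 1 / m ^ 2 * V + ε := by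
    simp only [mul_zero, add_zero, sub_zero, mul_one, one_div, inv_mul_eq_div]
    exact lt_add_of_pos_right _ hε
  have h3 := (h1.eventually_lt continuousAt_const h2).filter_mono
    (nhdsWithin_le_nhds (s := Ioi (0 : ℝ)))
  obtain ⟨η, h4, h5⟩ := (h3.and (Ioo_mem_nhdsGT (zero_lt_one (α := ℝ)))).exists
  exact ⟨η, h5, h4.le⟩

/-- Main theorem: upper bound for the limsup of the normalized second moment of
the dynamic mixture importance sampling estimator under conditions (3.1)-(3.3). -/
theorem stmt_1
    (n : ℕ) (hn : 1 ≤ n) (α : ℝ) (hα : 0 < α)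
    (f : ℝ → ℝ) (hf_nonneg : ∀ x, 0 ≤ f x)
    (hf_int : ∫ x, f x = 1)
    (hf_rv : ∀ x : ℝ, 0 < x →
      Tendsto (fun u => f (u * x) / f u) atTop (nhds (x ^ (-α - 1))))
    (Fbar : ℝ → ℝ) (hFbar : ∀ b, Fbar b = ∫ t in Ioi b, f t)
    (hFbar_pos : ∀ b, 0 < Fbar b)
    (p : ℕ → ℝ) (hp : ∀ i, 1 ≤ i → i < n → p i ∈ Ioo (0 : ℝ) 1)
    (q : ℕ → ℝ) (hq : ∀ i, q i = if i = n then 1 else 1 - p i)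
    (g : ℕ → ℝ → ℝ → ℝ → ℝ)
    (hg_nonneg : ∀ i b s x, 0 ≤ g i b s x)
    (hg_dens : ∀ i b s, 1 ≤ i → i ≤ n → ∫ x, g i b s x = 1)
    (ψ : ℕ → ℝ → ℝ → ℝ → ℝ)
    (hψ : ∀ i b s x, ψ i b s x =
      if b < s then f x
      else if i < n then p i * f x + (1 - p i) * g i b s x
      else g i b s x)
    (S : (Fin n → ℝ) → ℕ → ℝ)
    (hS : ∀ y k, S y k = ∑ j ∈ Finset.univ.filter (fun j : Fin n => (j : ℕ) < k), y j)
    (pb : ℝ → ℝ)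
    (hpb : ∀ b, pb b = ∫ x in {x : Fin n → ℝ | b < S x n}, ∏ i : Fin n, f (x i))
    (Ep2 : ℝ → ℝ)
    (hEp2 : ∀ b, Ep2 b = ∫ x in {x : Fin n → ℝ | b < S x n},
      ∏ i : Fin n, (f (x i)) ^ 2 / ψ ((i : ℕ) + 1) b (S x (i : ℕ)) (x i))
    (a : ℝ) (ha : a ∈ Ioo (0 : ℝ) 1)
    -- condition (3.1)
    (h31 : ∀ i, 1 ≤ i → i ≤ n → ∃ ε > (0 : ℝ), ∃ b0 : ℝ, ∀ b ≥ b0, ∀ s y : ℝ,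
      s ≤ 1 - (1 - a) ^ (i - 1) → a * (1 - s) < y →
      ε ≤ g i b (b * s) (b * y) / f (b * y) * Fbar b)
    -- condition (3.2)
    (h32 : ∃ M : ℝ, ∃ b0 : ℝ, ∀ b ≥ b0, ∀ s y : ℝ,
      s ≤ 1 → 1 - s < y → f (b * y) / g n b (b * s) (b * y) ≤ M)
    -- condition (3.3): uniform convergence to continuous nonnegative h i
    (h : ℕ → ℝ → ℝ → ℝ)
    (hh_cont : ∀ i, 1 ≤ i → i ≤ n → Continuous fun z : ℝ × ℝ => h i z.1 z.2)
    (hh_nonneg : ∀ i y s, 0 ≤ h i y s)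
    (h33 : ∀ i, 1 ≤ i → i ≤ n → ∀ ε > (0 : ℝ), ∃ b0 : ℝ, ∀ b ≥ b0, ∀ s y : ℝ,
      s ≤ 1 - (1 - a) ^ (i - 1) → a * (1 - s) < y →
      |f (b * y) / (g i b (b * s) (b * y) * Fbar b) - h i y s| ≤ ε) :
    -- limsup_{b→∞} E p̂_b² / p_b² ≤ (1/n²) Σ_i (Π_{j<i} 1/p_j)(1/q_i) ∫_1^∞ h_i(y|0) α y^{-α-1} dy
    ∀ ε > (0 : ℝ), ∃ b0 : ℝ, ∀ b ≥ b0, Ep2 b / (pb b) ^ 2 ≤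
      (1 / (n : ℝ) ^ 2) * (∑ i ∈ Finset.Icc 1 n,
        (∏ j ∈ Finset.Ico 1 i, (p j)⁻¹) * (q i)⁻¹ *
          ∫ y in Ioi (1 : ℝ), h i y 0 * (α * y ^ (-α - 1))) + ε := by
  have hSp : ∀ x k, S x k = prefixSum x k := hS
  have hpos : ∀ b, 0 < ∫ t in Ioi b, f t := fun b => hFbar b ▸ hFbar_pos b
  have hqpos : ∀ i, 1 ≤ i → i ≤ n → 0 < q i := by
    intro i hi hin
    rw [hq]
    split_ifs with h1
    · exact one_pos
    · exact sub_pos.2 (hp i hi (lt_of_le_of_ne hin h1)).2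
  have hψ_nonneg : ∀ i b s x, 1 ≤ i → 0 ≤ ψ i b s x := by
    intro i b s x hi
    rw [hψ]
    split_ifs with h1 h2
    · exact hf_nonneg x
    · have := hp i hi h2
      exact add_nonneg (mul_nonneg this.1.le (hf_nonneg x))
        (mul_nonneg (sub_pos.2 this.2).le (hg_nonneg _ _ _ _))
    · exact hg_nonneg _ _ _ _
  obtain ⟨M, bM, hM⟩ := h32
  set d : ℕ → ℝ := fun j => if j + 1 < n then (p (j + 1))⁻¹ else max M 1 with hd_def
  set v : Fin n → ℝ := fun k => (q (k + 1))⁻¹ with hv_def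
  have hd : ∀ j < n, 1 ≤ d j := by
    intro j _
    simp only [hd_def]
    split_ifs with h1
    · have := hp (j + 1) (Nat.le_add_left 1 j) h1
      exact (one_le_inv₀ this.1).2 this.2.le
    · exact le_max_right _ _
  have hidx : ∀ k : Fin n, 1 ≤ (k : ℕ) + 1 ∧ (k : ℕ) + 1 ≤ n := fun k =>
    ⟨Nat.le_add_left 1 k, k.isLt⟩
  choose ε₁ hε₁ b₁ hb₁ using fun k : Fin n => h31 (k + 1) (hidx k).1 (hidx k).2
  simp only [Nat.add_sub_cancel] at hb₁
  have h33' : ∀ k : Fin n, ∀ ε > (0 : ℝ), ∃ b0 : ℝ, ∀ b ≥ b0, ∀ s y : ℝ,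
      s ≤ 1 - (1 - a) ^ (k : ℕ) → a * (1 - s) < y →
      |f (b * y) / (g (k + 1) b (b * s) (b * y) * Fbar b) - h (k + 1) y s| ≤ ε := fun k =>
    h33 (k + 1) (hidx k).1 (hidx k).2
  have hle_inv : ∀ k : Fin n, ∀ b ≥ b₁ k, ∀ s y : ℝ, s ≤ 1 - (1 - a) ^ (k : ℕ) →
      a * (1 - s) < y → f (b * y) / (g (k + 1) b (b * s) (b * y) * Fbar b) ≤ (ε₁ k)⁻¹ := by
    intro k b hb s y hs hy
    have := inv_anti₀ (hε₁ k) (hb₁ k b hb s y hs hy)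
    rwa [mul_inv, inv_div, ← div_eq_mul_inv, div_div] at this
  have hpow_le : ∀ k : ℕ, (1 - a) ^ k ≤ 1 := fun k =>
    pow_le_one₀ (sub_pos.2 ha.2).le (by linarith [ha.1])
  have hhC : ∀ (k : Fin n) (y : ℝ), 1 ≤ y → h (k + 1) y 0 ≤ (ε₁ k)⁻¹ + 1 := by
    intro k y hy
    obtain ⟨b0, hb0⟩ := h33' k 1 one_pos
    have h1 : (0 : ℝ) ≤ 1 - (1 - a) ^ (k : ℕ) := sub_nonneg.2 (hpow_le k)
    have h2 : a * (1 - 0) < y := by linarith [ha.2]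
    have h3 := (abs_le.1 (hb0 _ (le_max_left b0 (b₁ k)) 0 y h1 h2)).1
    have h4 := hle_inv k _ (le_max_right b0 (b₁ k)) 0 y h1 h2
    linarith
  have hratio : ∀ k : Fin n, ∀ᶠ b in atTop, ∀ x : Fin n → ℝ,
      b * (1 - a) ^ (k : ℕ) ≤ b - prefixSum x k → a * (b - prefixSum x k) < x k →
      prefixSum x k / b ≤ 1 - (1 - a) ^ (k : ℕ) ∧ a * (1 - prefixSum x k / b) < x k / b ∧
      f (x k) / ψ (k + 1) b (S x k) (x k) ≤ v k * (∫ t in Ioi b, f t) *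
        (f (b * (x k / b)) /
          (g (k + 1) b (b * (prefixSum x k / b)) (b * (x k / b)) * Fbar b)) := by
    intro k
    filter_upwards [eventually_ge_atTop (b₁ k), eventually_gt_atTop 0] with b hb hb0 x hx1 hx2
    have hs : prefixSum x k / b ≤ 1 - (1 - a) ^ (k : ℕ) := by
      rw [div_le_iff₀ hb0]; linarith
    have hy : a * (1 - prefixSum x k / b) < x k / b := by
      rw [lt_div_iff₀ hb0, mul_assoc, sub_mul, one_mul, div_mul_cancel₀ _ hb0.ne']
      exact hx2
    refine ⟨hs, hy, ?_⟩
    have h1 := (hε₁ k).trans_le (hb₁ k b hb _ _ hs hy)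
    rw [mul_div_cancel₀ _ hb0.ne', mul_div_cancel₀ _ hb0.ne'] at h1 ⊢
    have hg0 : 0 < g (k + 1) b (prefixSum x k) (x k) := by
      refine lt_of_le_of_ne (hg_nonneg _ _ _ _) fun h2 => ?_
      simp [← h2] at h1
    have hSb : ¬ b < S x k := by
      rw [hSp, not_lt]
      have := mul_pos hb0 (pow_pos (sub_pos.2 ha.2) k)
      linarith
    have h2 : f (x k) / ψ (k + 1) b (S x k) (x k) ≤
        v k * (f (x k) / g (k + 1) b (prefixSum x k) (x k)) := by
      rw [hψ, if_neg hSb, hSp]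
      simp only [hv_def, hq]
      split_ifs with h3 h4 h4
      · omega
      · exact div_mixture_le_mul_div (hp _ (hidx k).1 h3) (hf_nonneg _) hg0
      · simp
      · exact absurd (lt_of_le_of_ne (hidx k).2 h4) h3
    refine h2.trans (le_of_eq ?_)
    have := (hFbar_pos b).ne'
    rw [← hFbar]
    field_simp
  have hnR : (0 : ℝ) < n := by exact_mod_cast hn
  set V : ℝ := ∑ k : Fin n, (∏ j ∈ Finset.range k, d j) * v k *
    ∫ y in Ioi (1 : ℝ), h (k + 1) y 0 * (α * y ^ (-α - 1)) with hV_def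
  have hV : ∑ i ∈ Finset.Icc 1 n, (∏ j ∈ Finset.Ico 1 i, (p j)⁻¹) * (q i)⁻¹ *
      ∫ y in Ioi (1 : ℝ), h i y 0 * (α * y ^ (-α - 1)) = V := by
    rw [hV_def, ← Finset.Ico_add_one_right_eq_Icc, Finset.sum_Ico_eq_sum_range,
      Nat.add_sub_cancel, ← Fin.sum_univ_eq_sum_range]
    refine Finset.sum_congr rfl fun k _ => ?_
    rw [Finset.prod_Ico_eq_prod_range, Nat.add_sub_cancel_left, add_comm 1 (k : ℕ)]
    congr 2
    refine Finset.prod_congr rfl fun j hj => ?_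
    have := Finset.mem_range.1 hj
    rw [hd_def, add_comm 1 j]
    exact (if_pos (by omega)).symm
  rw [hV]
  intro ε hε
  obtain ⟨η, hη, hηε⟩ := exists_add_mul_div_sq_le V hnR hε
  have hupper := eventually_setIntegral_prod_mul_le hα hf_nonneg hf_int hf_rv hpos ha
    (r := fun b x j => f (x j) / ψ (j + 1) b (S x j) (x j)) (d := d) (v := v)
    (h := fun k => h (k + 1)) (C := fun k => (ε₁ k)⁻¹ + 1)
    (fun k => hh_cont _ (hidx k).1 (hidx k).2) (fun k => hh_nonneg _) hhC hd
    (fun k => inv_pos.2 (hqpos _ (hidx k).1 (hidx k).2))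
    (fun k => add_nonneg (inv_nonneg.2 (hε₁ k).le) zero_le_one)
    (fun b x j => div_nonneg (hf_nonneg _) (hψ_nonneg _ _ _ _ (hidx j).1))
    ?_ ?_ ?_ ?_ hη.1
  · have hlower := eventually_mul_tail_le_tail_sum hf_nonneg hf_int hf_rv hpos n hη.1
    have hset : ∀ b, {x : Fin n → ℝ | b < S x n} = {x | b < ∑ j, x j} := fun b => by
      simp only [hSp, prefixSum_self]
    refine eventually_atTop.1 ?_
    filter_upwards [hupper, hlower] with b hu hl
    have hE : Ep2 b ≤ (∫ t in Ioi b, f t) ^ 2 * (V + n * η) := by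
      rw [hEp2, hset]
      simpa only [sq (f _), mul_div_assoc] using hu
    rw [← hset, ← hpb] at hl
    have hT := hpos b
    have hlpos : 0 < n * (1 - η) * ∫ t in Ioi b, f t :=
      mul_pos (mul_pos hnR (sub_pos.2 hη.2)) hT
    have hV0 : 0 ≤ V + n * η := by
      refine add_nonneg (Finset.sum_nonneg fun k _ => mul_nonneg (mul_nonneg ?_ ?_) ?_)
        (mul_nonneg hnR.le hη.1.le)
      · exact Finset.prod_nonneg fun j hj =>
          zero_le_one.trans (hd j ((Finset.mem_range.1 hj).trans k.isLt))
      · exact (inv_pos.2 (hqpos _ (hidx k).1 (hidx k).2)).le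
      · refine setIntegral_nonneg measurableSet_Ioi fun y hy => ?_
        have : 0 < y := one_pos.trans hy
        exact mul_nonneg (hh_nonneg _ _ _) (mul_nonneg hα.le (rpow_nonneg this.le _))
    calc Ep2 b / pb b ^ 2
        ≤ (∫ t in Ioi b, f t) ^ 2 * (V + n * η) / (n * (1 - η) * ∫ t in Ioi b, f t) ^ 2 :=
          div_le_div₀ (mul_nonneg (sq_nonneg _) hV0) hE (pow_pos hlpos 2)
            (pow_le_pow_left₀ hlpos.le hl 2)
      _ = (V + n * η) / (n * (1 - η)) ^ 2 := by
          rw [mul_pow _ (∫ t in Ioi b, f t), mul_comm, mul_div_mul_right _ _ (pow_pos hT 2).ne']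
      _ ≤ _ := hηε
  · filter_upwards [eventually_ge_atTop bM, eventually_gt_atTop 0] with b hb hb0 x hx j
    rw [hψ]
    split_ifs with h1 h2
    · exact (div_self_le_one _).trans (hd j j.isLt)
    · simp only [hd_def, if_pos h2]
      exact div_mixture_le_inv_left (hp _ (hidx j).1 h2) (hf_nonneg _) (hg_nonneg _ _ _ _)
    · have hjn : (j : ℕ) + 1 = n := le_antisymm (hidx j).2 (not_lt.1 h2)
      simp only [hd_def, if_neg h2]
      refine le_trans ?_ (le_max_left M 1)
      rw [← prefixSum_self, ← congrArg (prefixSum x) hjn, prefixSum_succ] at hx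
      have h3 := hM b hb (S x j / b) (x j / b)
        ((div_le_one hb0).2 (not_lt.1 h1)) (by
          rw [hSp, sub_lt_iff_lt_add', ← add_div, one_lt_div hb0]; exact hx)
      rw [mul_div_cancel₀ _ hb0.ne', mul_div_cancel₀ _ hb0.ne'] at h3
      rwa [congrArg g hjn]
  · intro b x j hbj
    rw [hψ, if_pos (by rwa [hSp])]
    exact div_self_le_one _
  · intro k
    filter_upwards [hratio k, eventually_ge_atTop (b₁ k)] with b hb hb1 x hx1 hx2
    obtain ⟨hs, hy, hr⟩ := hb x hx1 hx2
    refine hr.trans (mul_le_mul_of_nonneg_left ?_ (mul_nonneg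
      (inv_pos.2 (hqpos _ (hidx k).1 (hidx k).2)).le (hpos b).le))
    exact (hle_inv k b hb1 _ _ hs hy).trans (le_add_of_nonneg_right zero_le_one)
  · intro k ε' hε'
    obtain ⟨b0, hb0⟩ := h33' k ε' hε'
    filter_upwards [hratio k, eventually_ge_atTop b0] with b hb hb1 x hx1 hx2
    obtain ⟨hs, hy, hr⟩ := hb x hx1 hx2
    refine hr.trans (mul_le_mul_of_nonneg_left ?_ (mul_nonneg
      (inv_pos.2 (hqpos _ (hidx k).1 (hidx k).2)).le (hpos b).le))
    linarith [(abs_le.1 (hb0 b hb1 _ _ hs hy)).2]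
end
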